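/- arXiv:1802.09449 — 2 statements merged into one kernel-verified Lean document; each statement's English description precedes it below -/
import Mathlib

section
/- Let p > 2 be a prime, G = PSL₂(p), and let A ⊆ G be a maximal coclique which is not the underlying set of a maximal subgroup of G. Suppose A contains an element x of order greater than 2 such that every element of A not lying in the cyclic subgroup ⟨x⟩ has order 2. If the order of x divides p − 1 and G contains A₄ as a maximal subgroup, then |A| ≤ (7/2)(p − 1) + 5, i.e. 2·|A| ≤ 7(p − 1) + 10. -/
open scoped MatrixGroups

/-- A subset `A` of a group `G` is a *coclique* if any two of its elements
generate a proper subgroup of `G`. -/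
def IsCoclique {G : Type*} [Group G] (A : Set G) : Prop :=
  ∀ g ∈ A, ∀ h ∈ A, Subgroup.closure {g, h} ≠ ⊤

/-- A coclique is *maximal* if the only coclique containing it is itself. -/
def IsMaximalCoclique {G : Type*} [Group G] (A : Set G) : Prop :=
  IsCoclique A ∧ ∀ B : Set G, IsCoclique B → A ⊆ B → A = B

/-- `G` contains a maximal subgroup isomorphic to `H`. -/
def HasMaximalSubgroupIsoTo (G : Type*) [Group G] (H : Type*) [Group H] : Prop :=
  ∃ M : Subgroup G, IsCoatom M ∧ Nonempty (M ≃* H)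

theorem klein_orbit_arithmetic {n r₀ r₁ r₂ a₀ a₁ a₂ : ℕ} (h₀ : r₀ * a₀ = n) (h₁ : r₁ * a₁ = n)
    (h₂ : r₂ * a₂ = n) (hr₀ : 3 ≤ r₀) (hr₁ : 2 ≤ r₁) (hr₂ : 2 ≤ r₂)
    (hsum : a₀ + a₁ + a₂ = n + 2) :
    (r₁ = 2 ∧ r₂ = 2 ∧ a₀ = 2) ∨ (r₀ ≤ 5 ∧ r₁ ≤ 5 ∧ r₂ ≤ 5) := by
  have key : ∀ {r a : ℕ}, r * a = n → 2 ≤ r →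
      (r = 2 ∧ 2 * a = n) ∨ (3 ≤ r ∧ r ≤ 5 ∧ 3 * a ≤ n) ∨ (6 ≤ r ∧ 6 * a ≤ n) := by
    intro r a h hr
    rcases (show r = 2 ∨ (3 ≤ r ∧ r ≤ 5) ∨ 6 ≤ r by omega) with h2 | ⟨h3, h5⟩ | h6
    · subst h2; exact .inl ⟨rfl, h⟩
    · exact .inr (.inl ⟨h3, h5, h ▸ Nat.mul_le_mul_right a h3⟩)
    · exact .inr (.inr ⟨h6, h ▸ Nat.mul_le_mul_right a h6⟩)
  have k₀ := key h₀ (by omega)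
  have k₁ := key h₁ hr₁
  have k₂ := key h₂ hr₂
  omega

section Klein

open MulAction

variable {H X : Type*} [Group H] [MulAction H X]

theorem card_stabilizer_mul_ncard_orbit (P : X) :
    Nat.card (stabilizer H P) * (orbit H P).ncard = Nat.card H := by
  rw [← index_stabilizer, Subgroup.card_mul_index]

theorem orderOf_le_card_stabilizer [Finite H] {h : H} {P : X} (hP : h • P = P) :
    orderOf h ≤ Nat.card (stabilizer H P) :=
  Subgroup.orderOf_le_card _ (Set.toFinite _) (mem_stabilizer_iff.2 hP)

variable [Finite H] [Finite X]

theorem sum_card_sub_ncard_orbit (hfix : ∀ h : H, h ≠ 1 → (fixedBy X h).ncard = 2)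
    [Fintype (orbitRel.Quotient H X)] :
    ∑ ω : orbitRel.Quotient H X, (Nat.card H - (orbit H ω.out).ncard) = 2 * (Nat.card H - 1) := by
  classical
  have := Fintype.ofFinite H
  have := Fintype.ofFinite X
  have hX : Fintype.card X = ∑ ω : orbitRel.Quotient H X, (orbit H ω.out).ncard := by
    rw [Fintype.card_congr (selfEquivSigmaOrbits H X), Fintype.card_sigma]
    simp [Set.ncard_eq_toFinset_card']
  have hB := sum_card_fixedBy_eq_card_orbits_mul_card_group H X
  rw [← Finset.add_sum_erase _ _ (Finset.mem_univ (1 : H)),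
    Finset.sum_congr rfl (g := fun _ => 2) (fun h hh => by
      rw [← Nat.card_eq_fintype_card, Nat.card_coe_set_eq]
      exact hfix h (Finset.ne_of_mem_erase hh))] at hB
  have h1 : Fintype.card (fixedBy X (1 : H)) = Fintype.card X := by
    simp
  rw [h1, hX] at hB
  simp only [Finset.sum_const, Finset.card_erase_of_mem (Finset.mem_univ _), Finset.card_univ,
    smul_eq_mul] at hB
  have hle : ∀ ω : orbitRel.Quotient H X, (orbit H ω.out).ncard ≤ Nat.card H := fun ω =>
    Nat.le_of_dvd Nat.card_pos ⟨_, (mul_comm _ _).trans (card_stabilizer_mul_ncard_orbit _) |>.symm⟩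
  have hadd : ∑ ω : orbitRel.Quotient H X, (Nat.card H - (orbit H ω.out).ncard) +
      ∑ ω : orbitRel.Quotient H X, (orbit H ω.out).ncard =
      Fintype.card (orbitRel.Quotient H X) * Nat.card H := by
    rw [← Finset.sum_add_distrib, Finset.sum_congr rfl (fun ω _ => Nat.sub_add_cancel (hle ω))]
    simp
  have hq : Fintype.card (Quotient (orbitRel H X)) = Fintype.card (orbitRel.Quotient H X) :=
    Fintype.card_congr (Equiv.refl _)
  rw [hq] at hB
  rw [Nat.card_eq_fintype_card] at *
  omega

/-- A finite group acting so that each non-trivial element has exactly two fixed points, and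
containing an element of order at least three, is cyclic, dihedral or polyhedral. -/
theorem klein_trichotomy (hfix : ∀ h : H, h ≠ 1 → (fixedBy X h).ncard = 2) {x : H}
    (hx : 3 ≤ orderOf x) :
    (∃ P ∈ fixedBy X x, ∀ h : H, h • P = P) ∨
      (∀ P ∈ fixedBy X x, ∀ h : H, h • P ∈ fixedBy X x) ∨ ∀ h : H, orderOf h ≤ 5 := by
  classical
  have := Fintype.ofFinite (orbitRel.Quotient H X)
  set n := Nat.card H with hn
  have hxn : 3 ≤ n := hx.trans (orderOf_le_card)
  have hx1 : x ≠ 1 := by rintro rfl; simp at hx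
  let a : orbitRel.Quotient H X → ℕ := fun ω => (orbit H ω.out).ncard
  let r : orbitRel.Quotient H X → ℕ := fun ω => Nat.card (stabilizer H ω.out)
  have hra : ∀ ω, r ω * a ω = n := fun ω => card_stabilizer_mul_ncard_orbit _
  have horb : ∀ P : X, orbit H (⟦P⟧ : orbitRel.Quotient H X).out = orbit H P := fun P =>
    orbit_eq_iff.2 (Quotient.exact (Quotient.out_eq (⟦P⟧ : orbitRel.Quotient H X)))
  have hrP : ∀ P : X, r ⟦P⟧ = Nat.card (stabilizer H P) := fun P => by
    have h1 := hra ⟦P⟧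
    rw [show a ⟦P⟧ = (orbit H P).ncard from congrArg Set.ncard (horb P), hn,
      ← card_stabilizer_mul_ncard_orbit P] at h1
    exact Nat.eq_of_mul_eq_mul_right
      (Nat.pos_of_ne_zero (fun h0 => by
        rw [Set.ncard_eq_zero] at h0; exact (nonempty_orbit P).ne_empty h0)) h1
  have hpos : ∀ ω, 0 < a ω := fun ω => Nat.pos_of_ne_zero fun h0 => by
    have := hra ω; rw [h0] at this; omega
  have hsum : ∑ ω, (n - a ω) = 2 * (n - 1) := sum_card_sub_ncard_orbit hfix
  have hr_of : ∀ (h : H) (P : X), h • P = P → orderOf h ≤ r ⟦P⟧ := fun h P hP => by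
    rw [hrP]; exact orderOf_le_card_stabilizer hP
  set S := Finset.univ.filter (fun ω => 2 ≤ r ω) with hS
  have hS' : ∀ ω, ω ∉ S → n - a ω = 0 := fun ω hω => by
    have h1 : r ω < 2 := by simpa [hS] using hω
    have h2 := hra ω
    have : r ω ≠ 0 := by intro h; rw [h] at h2; omega
    have : r ω = 1 := by omega
    rw [this] at h2; omega
  have hsumS : ∑ ω ∈ S, (n - a ω) = 2 * (n - 1) := by
    rw [← hsum]
    exact Finset.sum_subset (Finset.subset_univ _) (fun ω _ hω => hS' ω hω)
  have hlow : ∀ ω ∈ S, n ≤ 2 * (n - a ω) := fun ω hω => by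
    have h1 : 2 ≤ r ω := by simpa [hS] using hω
    have h2 := Nat.mul_le_mul_right (a ω) h1
    rw [hra] at h2; omega
  have hcard : S.card ≤ 3 := by
    have h1 : S.card * n ≤ ∑ ω ∈ S, 2 * (n - a ω) := by
      rw [← smul_eq_mul]; exact Finset.card_nsmul_le_sum _ _ _ hlow
    rw [← Finset.mul_sum, hsumS] at h1
    by_contra! h
    have := Nat.mul_le_mul_right n (show 4 ≤ S.card from h)
    omega
  obtain ⟨P, hP⟩ : (fixedBy X x).Nonempty := by
    rw [← Set.ncard_pos, hfix x hx1]; norm_num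
  have hPr : 3 ≤ r ⟦P⟧ := hx.trans (hr_of x P hP)
  have hPS : ⟦P⟧ ∈ S := by simp [hS]; omega
  have hsumE := Finset.add_sum_erase S (fun ω => n - a ω) hPS
  have hcE := Finset.card_erase_of_mem hPS
  have hcpos : 0 < S.card := Finset.card_pos.2 ⟨_, hPS⟩
  rw [hsumS] at hsumE
  have h0 := hpos ⟦P⟧
  rcases (show (S.erase ⟦P⟧).card = 0 ∨ (S.erase ⟦P⟧).card = 1 ∨ (S.erase ⟦P⟧).card = 2 by omega)
    with hc | hc | hc
  · rw [Finset.card_eq_zero] at hc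
    rw [hc] at hsumE
    simp at hsumE
    omega
  · obtain ⟨ω, hω⟩ := Finset.card_eq_one.1 hc
    rw [hω] at hsumE
    simp only [Finset.sum_singleton] at hsumE
    have := hpos ω
    left
    refine ⟨P, hP, fun h => ?_⟩
    have h1 : (orbit H P).ncard = 1 := by
      rw [← horb P]; change a ⟦P⟧ = 1; omega
    obtain ⟨Q, hQ⟩ := Set.ncard_eq_one.1 h1
    have h2 := mem_orbit_self (M := H) P
    have h3 := mem_orbit P h
    rw [hQ] at h2 h3
    exact h3.trans h2.symm
  · obtain ⟨ω₁, ω₂, hne, hω⟩ := Finset.card_eq_two.1 hc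
    rw [hω, Finset.sum_pair hne] at hsumE
    have hmem : ∀ ω, 2 ≤ r ω ↔ ω = ⟦P⟧ ∨ ω = ω₁ ∨ ω = ω₂ := fun ω => by
      have : ω ∈ insert ⟦P⟧ (S.erase ⟦P⟧) ↔ ω ∈ S := by rw [Finset.insert_erase hPS]
      rw [hω] at this
      simpa [hS] using this.symm
    have hr₁ : 2 ≤ r ω₁ := (hmem _).2 (by simp)
    have hr₂ : 2 ≤ r ω₂ := (hmem _).2 (by simp)
    have hle : ∀ ω, a ω ≤ n := fun ω =>
      Nat.le_of_dvd (by omega) ⟨_, (hra ω).symm.trans (mul_comm _ _)⟩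
    have hl₀ := hle ⟦P⟧
    have hl₁ := hle ω₁
    have hl₂ := hle ω₂
    right
    rcases klein_orbit_arithmetic (hra ⟦P⟧) (hra ω₁) (hra ω₂) hPr hr₁ hr₂ (by omega) with
      ⟨e₁, e₂, e₀⟩ | ⟨l₀, l₁, l₂⟩
    · left
      have hsub : fixedBy X x ⊆ orbit H P := fun Q hQ => by
        have h3 : 3 ≤ r ⟦Q⟧ := hx.trans (hr_of x Q hQ)
        rcases (hmem ⟦Q⟧).1 (by omega) with h | h | h
        · exact Quotient.exact h
        · rw [h] at h3; omega
        · rw [h] at h3; omega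
      have heq : fixedBy X x = orbit H P := by
        refine Set.eq_of_subset_of_ncard_le hsub ?_
        rw [hfix x hx1, ← horb P]
        exact e₀.le
      intro Q hQ h
      rw [heq] at hQ ⊢
      exact mem_orbit_of_mem_orbit h hQ
    · right
      intro h
      by_cases h1 : h = 1
      · simp [h1]
      obtain ⟨Q, hQ⟩ : (fixedBy X h).Nonempty := by
        rw [← Set.ncard_pos, hfix h h1]; norm_num
      have h2 := hr_of h Q hQ
      by_cases h3 : 2 ≤ r ⟦Q⟧
      · rcases (hmem ⟦Q⟧).1 h3 with h | h | h <;> rw [h] at h2 <;> omega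
      · omega

end Klein

section ProjectiveSpecialLinear

open Matrix

variable {F : Type*} [Field F]

/-- The projection from `SL₂(F)` onto `PSL₂(F)`. -/
abbrev toPSL (F : Type*) [Field F] : SL(2, F) →* PSL(2, F) :=
  QuotientGroup.mk' (Subgroup.center SL(2, F))

theorem toPSL_surjective : Function.Surjective (toPSL F) := QuotientGroup.mk'_surjective _

theorem toPSL_eq_one_iff {X : SL(2, F)} : toPSL F X = 1 ↔ X = 1 ∨ X = -1 := by
  rw [QuotientGroup.mk'_apply, QuotientGroup.eq_one_iff, Matrix.SpecialLinearGroup.mem_center_iff]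
  constructor
  · rintro ⟨r, hr, hX⟩
    have h1 : r = 1 ∨ r = -1 := by
      simpa using hr
    rcases h1 with rfl | rfl
    · left; ext i j; rw [← hX]; simp
    · right; ext i j; rw [← hX]; fin_cases i <;> fin_cases j <;> simp
  · rintro (rfl | rfl)
    · exact ⟨1, by simp, by simp⟩
    · refine ⟨-1, by simp, ?_⟩
      ext i j; fin_cases i <;> fin_cases j <;> simp

theorem toPSL_neg (X : SL(2, F)) : toPSL F (-X) = toPSL F X := by
  have h : toPSL F (-1) = 1 := toPSL_eq_one_iff.2 (.inr rfl)
  rw [← neg_one_mul, map_mul, h, one_mul]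

theorem toPSL_eq_iff {X Y : SL(2, F)} : toPSL F X = toPSL F Y ↔ X = Y ∨ X = -Y := by
  rw [← mul_inv_eq_one, ← map_inv, ← map_mul, toPSL_eq_one_iff, mul_inv_eq_one,
    mul_inv_eq_iff_eq_mul, neg_one_mul]

theorem SL2_sq (X : SL(2, F)) :
    (X : Matrix (Fin 2) (Fin 2) F) ^ 2 = X.1.trace • X.1 - 1 := by
  have h := X.2
  rw [det_fin_two] at h
  ext i j
  fin_cases i <;> fin_cases j <;> simp [sq, mul_apply, Fin.sum_univ_two, trace_fin_two] <;> grind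

theorem SL2_pow_three (X : SL(2, F)) :
    (X : Matrix (Fin 2) (Fin 2) F) ^ 3 =
      (X.1.trace ^ 2 - 1) • X.1 - X.1.trace • (1 : Matrix (Fin 2) (Fin 2) F) := by
  rw [pow_succ, SL2_sq, sub_mul, smul_mul_assoc, one_mul, ← sq, SL2_sq]
  module

theorem SL2_pow_four (X : SL(2, F)) :
    (X : Matrix (Fin 2) (Fin 2) F) ^ 4 = (X.1.trace * (X.1.trace ^ 2 - 2)) • X.1 -
      (X.1.trace ^ 2 - 1) • (1 : Matrix (Fin 2) (Fin 2) F) := by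
  rw [pow_succ, SL2_pow_three, sub_mul, smul_mul_assoc, smul_mul_assoc, one_mul, ← sq, SL2_sq]
  module

theorem SL2_pow_five (X : SL(2, F)) :
    (X : Matrix (Fin 2) (Fin 2) F) ^ 5 = (X.1.trace ^ 4 - 3 * X.1.trace ^ 2 + 1) • X.1 -
      (X.1.trace * (X.1.trace ^ 2 - 2)) • (1 : Matrix (Fin 2) (Fin 2) F) := by
  rw [pow_succ, SL2_pow_four, sub_mul, smul_mul_assoc, smul_mul_assoc, one_mul, ← sq, SL2_sq]
  module

theorem toPSL_eq_one_of_coe_eq_smul {X : SL(2, F)} {c : F}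
    (h : (X : Matrix (Fin 2) (Fin 2) F) = c • (1 : Matrix (Fin 2) (Fin 2) F)) : toPSL F X = 1 := by
  have hd := X.2
  rw [h, det_smul, det_one] at hd
  rw [QuotientGroup.mk'_apply, QuotientGroup.eq_one_iff, Matrix.SpecialLinearGroup.mem_center_iff]
  exact ⟨c, by simpa using hd, by rw [h]; ext i j; fin_cases i <;> fin_cases j <;> simp⟩

theorem coeff_eq_zero_of_toPSL_pow_eq_one {X : SL(2, F)} {n : ℕ} {u v : F}
    (hn : (X : Matrix (Fin 2) (Fin 2) F) ^ n = u • X.1 - v • (1 : Matrix (Fin 2) (Fin 2) F))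
    (h1 : toPSL F X ≠ 1) (h : toPSL F X ^ n = 1) : u = 0 := by
  by_contra hu
  rw [← map_pow, toPSL_eq_one_iff] at h
  obtain ⟨w, hw⟩ : ∃ w : F, (X : Matrix (Fin 2) (Fin 2) F) ^ n = w • (1 : Matrix _ _ F) := by
    rcases h with h | h
    · exact ⟨1, by rw [← Matrix.SpecialLinearGroup.coe_pow, h]; simp⟩
    · exact ⟨-1, by rw [← Matrix.SpecialLinearGroup.coe_pow, h]; simp⟩
  refine h1 (toPSL_eq_one_of_coe_eq_smul (c := u⁻¹ * (w + v)) ?_)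
  have h2 : u • X.1 = (w + v) • (1 : Matrix (Fin 2) (Fin 2) F) := by
    rw [add_smul, ← hw, hn]; abel
  rw [mul_smul, ← h2, smul_smul, inv_mul_cancel₀ hu, one_smul]

theorem toPSL_sq_eq_one {X : SL(2, F)} (h : X.1.trace = 0) : toPSL F X ^ 2 = 1 := by
  rw [← map_pow]
  refine toPSL_eq_one_of_coe_eq_smul (c := -1) ?_
  rw [Matrix.SpecialLinearGroup.coe_pow, SL2_sq, h]
  simp

theorem trace_eq_zero_of_toPSL_sq {X : SL(2, F)} (h1 : toPSL F X ≠ 1) (h : toPSL F X ^ 2 = 1) :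
    X.1.trace = 0 :=
  coeff_eq_zero_of_toPSL_pow_eq_one (v := 1) (by rw [SL2_sq, one_smul]) h1 h

theorem trace_of_orderOf_eq_two {X : SL(2, F)} (h : orderOf (toPSL F X) = 2) : X.1.trace = 0 :=
  trace_eq_zero_of_toPSL_sq (by intro h1; simp [h1] at h) (orderOf_dvd_iff_pow_eq_one.1 h.dvd)

theorem trace_of_orderOf_eq_three {X : SL(2, F)} (h : orderOf (toPSL F X) = 3) :
    X.1.trace ^ 2 = 1 :=
  sub_eq_zero.1 (coeff_eq_zero_of_toPSL_pow_eq_one (SL2_pow_three X)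
    (by intro h1; simp [h1] at h) (by rw [← h, pow_orderOf_eq_one]))

theorem trace_of_orderOf_eq_four {X : SL(2, F)} (h : orderOf (toPSL F X) = 4) :
    X.1.trace ^ 2 = 2 := by
  have h1 := coeff_eq_zero_of_toPSL_pow_eq_one (SL2_pow_four X)
    (by intro h1; simp [h1] at h) (by rw [← h, pow_orderOf_eq_one])
  rcases mul_eq_zero.1 h1 with h2 | h2
  · have := orderOf_dvd_of_pow_eq_one (toPSL_sq_eq_one h2)
    rw [h] at this
    norm_num at this
  · exact sub_eq_zero.1 h2

theorem trace_of_orderOf_eq_five {X : SL(2, F)} (h : orderOf (toPSL F X) = 5) :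
    X.1.trace ^ 4 - 3 * X.1.trace ^ 2 + 1 = 0 :=
  coeff_eq_zero_of_toPSL_pow_eq_one (SL2_pow_five X)
    (by intro h1; simp [h1] at h) (by rw [← h, pow_orderOf_eq_one])

theorem exists_sq_eq_add_one_of_orderOf_eq_five {X : SL(2, F)} (h : orderOf (toPSL F X) = 5) :
    ∃ τ : F, τ ^ 2 = τ + 1 := by
  have h1 := trace_of_orderOf_eq_five h
  have h2 : (X.1.trace ^ 2 - X.1.trace - 1) * (X.1.trace ^ 2 + X.1.trace - 1) = 0 := by
    linear_combination h1
  rcases mul_eq_zero.1 h2 with h2 | h2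
  · exact ⟨X.1.trace, by linear_combination h2⟩
  · exact ⟨-X.1.trace, by linear_combination h2⟩

/-- The element of `SL₂(F)` with the given entries. -/
def mkSL2 (a b c d : F) (h : a * d - b * c = 1) : SL(2, F) :=
  ⟨!![a, b; c, d], by rw [det_fin_two_of, h]⟩

theorem coe_mkSL2 (a b c d : F) (h : a * d - b * c = 1) : (mkSL2 a b c d h).1 = !![a, b; c, d] :=
  rfl

theorem exists_eq_mkSL2 (X : SL(2, F)) : ∃ a b c d h, X = mkSL2 a b c d h := by
  induction X using Matrix.SpecialLinearGroup.fin_two_induction with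
  | _ a b c d h => exact ⟨a, b, c, d, h, rfl⟩

variable {a b c d a' b' c' d' : F} {h : a * d - b * c = 1} {h' : a' * d' - b' * c' = 1}

theorem mkSL2_mul : mkSL2 a b c d h * mkSL2 a' b' c' d' h' =
    mkSL2 (a * a' + b * c') (a * b' + b * d') (c * a' + d * c') (c * b' + d * d')
      (by linear_combination (a' * d' - b' * c') * h + h') := by
  apply Subtype.ext
  rw [Matrix.SpecialLinearGroup.coe_mul, coe_mkSL2, coe_mkSL2, coe_mkSL2, mul_fin_two]

theorem mkSL2_inv : (mkSL2 a b c d h)⁻¹ = mkSL2 d (-b) (-c) a (by linear_combination h) := by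
  apply Subtype.ext
  rw [Matrix.SpecialLinearGroup.coe_inv, coe_mkSL2, coe_mkSL2, adjugate_fin_two_of]

theorem mkSL2_neg : -(mkSL2 a b c d h) = mkSL2 (-a) (-b) (-c) (-d) (by linear_combination h) := by
  apply Subtype.ext
  rw [Matrix.SpecialLinearGroup.coe_neg, coe_mkSL2, coe_mkSL2]
  simp

theorem mkSL2_inj : mkSL2 a b c d h = mkSL2 a' b' c' d' h' ↔ a = a' ∧ b = b' ∧ c = c' ∧ d = d' := by
  refine Subtype.ext_iff.trans ?_
  rw [coe_mkSL2, coe_mkSL2]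
  simp [and_assoc]

theorem one_eq_mkSL2 : (1 : SL(2, F)) = mkSL2 1 0 0 1 (by simp) :=
  Subtype.ext one_fin_two

@[simp] theorem trace_mkSL2 : (mkSL2 a b c d h).1.trace = a + d := by
  simp [coe_mkSL2, trace_fin_two]

/-- An element of `SL₂(F)` with an eigenvalue in `F` is conjugate to an upper triangular matrix. -/
theorem exists_conj_upperTriangular {X : SL(2, F)} {e : F}
    (he : e ^ 2 - X.1.trace * e + 1 = 0) :
    ∃ (g : SL(2, F)) (f e' : F) (hf : e * e' - f * 0 = 1), g⁻¹ * X * g = mkSL2 e f 0 e' hf := by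
  obtain ⟨a, b, c, d, hd, rfl⟩ := exists_eq_mkSL2 X
  rw [trace_mkSL2] at he
  have key : ∀ v w : F, (v ≠ 0 ∨ w ≠ 0) → a * v + b * w = e * v → c * v + d * w = e * w →
      ∃ (g : SL(2, F)) (f e' : F) (hf : e * e' - f * 0 = 1),
        g⁻¹ * mkSL2 a b c d hd * g = mkSL2 e f 0 e' hf := by
    intro v w hvw h0 h1
    obtain ⟨y, z, hyz⟩ : ∃ y z : F, v * z - y * w = 1 := by
      rcases hvw with h | h
      · exact ⟨0, v⁻¹, by simp [h]⟩
      · exact ⟨-w⁻¹, 0, by simp [h]⟩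
    have he0 : e ≠ 0 := by rintro rfl; simp at he
    refine ⟨mkSL2 v y w z hyz, (z * a - y * c) * y + (z * b - y * d) * z, e⁻¹,
      by simp [he0], ?_⟩
    rw [mkSL2_inv, mkSL2_mul, mkSL2_mul, mkSL2_inj]
    have he' : e⁻¹ = a + d - e := by
      field_simp
      linear_combination he
    have e1 : (z * a + -y * c) * v + (z * b + -y * d) * w = e := by
      linear_combination z * h0 - y * h1 + e * hyz
    refine ⟨e1, by ring, by linear_combination v * h1 - w * h0, ?_⟩
    rw [he']
    linear_combination -e1 + (a + d) * hyz
  by_cases hb : b = 0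
  · subst hb
    by_cases hc : c = 0
    · subst hc
      have h2 : (e - a) * (e - d) = 0 := by linear_combination he + hd
      rcases mul_eq_zero.1 h2 with h3 | h3
      · exact key 1 0 (by simp) (by linear_combination -h3) (by simp)
      · exact key 0 1 (by simp) (by simp) (by linear_combination -h3)
    · exact key (e - d) c (.inr hc) (by linear_combination -hd - he) (by ring)
  · exact key b (e - a) (.inl hb) (by ring) (by linear_combination -hd - he)

end ProjectiveSpecialLinear

section Generation

open Matrix

variable {p : ℕ} [Fact p.Prime]

theorem trace_sq_of_orderOf_eq_prime {U : SL(2, ZMod p)} (hU : toPSL _ U ^ p = 1) :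
    U.1.trace = 2 ∨ U.1.trace = -2 := by
  have h1 := ZMod.trace_pow_card (p := p) U.1
  rw [ZMod.pow_card, ← Matrix.SpecialLinearGroup.coe_pow] at h1
  rw [← map_pow, toPSL_eq_one_iff] at hU
  rw [← h1]
  rcases hU with h | h <;> rw [h]
  · left; simp
  · right; simp

theorem subgroup_eq_top_of_upper_unitriangular {F : Type*} [Field F] {H : Subgroup SL(2, F)}
    (hE : ∀ t : F, mkSL2 1 t 0 1 (by simp) ∈ H) {a b c d : F} {h : a * d - b * c = 1}
    (hX : mkSL2 a b c d h ∈ H) (hc : c ≠ 0) : H = ⊤ := by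
  have hW : mkSL2 0 (-c⁻¹) c 0 (by simp [hc]) ∈ H := by
    have h1 := H.mul_mem (H.mul_mem (hE (-a / c)) hX) (hE (-d / c))
    rw [mkSL2_mul, mkSL2_mul] at h1
    convert h1 using 1
    rw [mkSL2_inj]
    refine ⟨?_, ?_, ?_, ?_⟩ <;> field_simp <;> grind
  have hL : ∀ t : F, mkSL2 1 0 t 1 (by simp) ∈ H := fun t => by
    have h1 := H.mul_mem (H.mul_mem hW (hE (-t / c ^ 2))) (H.inv_mem hW)
    rw [mkSL2_inv, mkSL2_mul, mkSL2_mul] at h1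
    convert h1 using 1
    rw [mkSL2_inj]
    refine ⟨?_, ?_, ?_, ?_⟩ <;> field_simp <;> grind
  rw [eq_top_iff]
  intro A _
  induction A using Matrix.SL2.transvection_induction with
  | hmul A B hA hB => exact H.mul_mem (hA trivial) (hB trivial)
  | htransvec i j hij t =>
    fin_cases i <;> fin_cases j
    · exact absurd rfl hij
    · convert hE t using 1
      apply Subtype.ext
      rw [coe_mkSL2, Matrix.SpecialLinearGroup.transvection_coe]
      ext i j; fin_cases i <;> fin_cases j <;> simp [single]
    · convert hL t using 1
      apply Subtype.ext
      rw [coe_mkSL2, Matrix.SpecialLinearGroup.transvection_coe]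
      ext i j; fin_cases i <;> fin_cases j <;> simp [single]
    · exact absurd rfl hij

theorem upper_unitriangular_pow {F : Type*} [Field F] (t : F) (n : ℕ) :
    mkSL2 1 t 0 1 (by simp) ^ n = mkSL2 1 (n * t) 0 1 (by simp) := by
  induction n with
  | zero => rw [pow_zero, one_eq_mkSL2, mkSL2_inj]; simp
  | succ n ih => rw [pow_succ, ih, mkSL2_mul, mkSL2_inj]; push_cast; grind

/-- A subgroup of `PSL₂(p)` of order divisible by `p` is everything or fixes a line. -/
theorem eq_top_or_triangular_of_orderOf_eq_prime {H : Subgroup PSL(2, ZMod p)}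
    {u : PSL(2, ZMod p)} (hu : u ∈ H) (hup : orderOf u = p) :
    H = ⊤ ∨ ∃ g : SL(2, ZMod p), ∀ X, toPSL _ X ∈ H → (g⁻¹ * X * g).1 1 0 = 0 := by
  obtain ⟨U, rfl⟩ := toPSL_surjective u
  have hpow := orderOf_dvd_iff_pow_eq_one.1 hup.dvd
  obtain ⟨e, he, he1⟩ : ∃ e : ZMod p, e ^ 2 - U.1.trace * e + 1 = 0 ∧ e * e = 1 := by
    rcases trace_sq_of_orderOf_eq_prime hpow with h | h <;> rw [h]
    · exact ⟨1, by ring, by ring⟩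
    · exact ⟨-1, by ring, by ring⟩
  obtain ⟨g, f, e', hf, hg⟩ := exists_conj_upperTriangular he
  obtain rfl : e' = e := by
    have h0 : e ≠ 0 := by rintro rfl; simp at he1
    refine mul_left_cancel₀ h0 ?_
    linear_combination hf - he1
  set K : Subgroup SL(2, ZMod p) := H.comap ((toPSL _).comp (MulAut.conj g).toMonoidHom) with hK
  have hmem : ∀ X, X ∈ K ↔ toPSL _ (g * X * g⁻¹) ∈ H := fun X => Iff.rfl
  have hmem' : ∀ X, toPSL _ X ∈ H ↔ g⁻¹ * X * g ∈ K := fun X => by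
    rw [hmem]; congr! 2; group
  have hnegK : -1 ∈ K := by
    rw [hmem, mul_neg, mul_one, neg_mul, mul_inv_cancel, toPSL_neg, map_one]; exact H.one_mem
  have hUK := (hmem' U).1 hu
  rw [hg] at hUK
  have hf0 : f ≠ 0 := by
    rintro rfl
    have h1 : toPSL _ (g⁻¹ * U * g) = 1 := by
      rw [hg]
      refine toPSL_eq_one_of_coe_eq_smul (c := e') ?_
      rw [coe_mkSL2]; ext i j; fin_cases i <;> fin_cases j <;> simp
    have h2 : toPSL _ U = 1 := by
      rw [map_mul, map_mul, map_inv] at h1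
      have := congrArg (fun z => toPSL _ g * z * (toPSL _ g)⁻¹) h1
      simpa [mul_assoc] using this
    rw [h2, orderOf_one] at hup
    exact (Fact.out : p.Prime).one_lt.ne hup
  have hE1 : mkSL2 1 (e' * f) 0 1 (by simp) ∈ K := by
    rcases mul_self_eq_one_iff.1 he1 with h | h
    · convert hUK using 1
      rw [mkSL2_inj]; simp [h]
    · convert K.mul_mem hnegK hUK using 1
      rw [neg_mul, one_mul (mkSL2 e' f 0 e' hf), mkSL2_neg, mkSL2_inj]; simp [h]
  have he0 : e' ≠ 0 := by rintro rfl; simp at he1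
  have hE : ∀ t : ZMod p, mkSL2 1 t 0 1 (by simp) ∈ K := fun t => by
    have h1 := K.pow_mem hE1 (t / (e' * f)).val
    rw [upper_unitriangular_pow] at h1
    convert h1 using 1
    rw [mkSL2_inj]
    simp only [ZMod.natCast_val, ZMod.cast_id', id_eq]
    field_simp
    simp
  by_cases hall : ∀ X ∈ K, X.1 1 0 = 0
  · exact .inr ⟨g, fun X hX => hall _ ((hmem' X).1 hX)⟩
  · left
    push Not at hall
    obtain ⟨X, hXK, hX⟩ := hall
    obtain ⟨a, b, c, d, h, rfl⟩ := exists_eq_mkSL2 X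
    have hKtop := subgroup_eq_top_of_upper_unitriangular hE hXK (by simpa [coe_mkSL2] using hX)
    rw [eq_top_iff]
    intro y _
    obtain ⟨Y, rfl⟩ := toPSL_surjective y
    rw [hmem', hKtop]
    trivial

end Generation

section Moebius

open Matrix OnePoint

variable (F K : Type*) [Field F] [Field K] [Algebra F K]

open Classical in
/-- The action of `PSL₂(F)` on the projective line over an extension of `F`. -/
noncomputable def moebiusHom : PSL(2, F) →* Equiv.Perm (OnePoint K) :=
  QuotientGroup.lift _ ((MulAction.toPermHom (GL (Fin 2) K) (OnePoint K)).comp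
    (Matrix.SpecialLinearGroup.toGL.comp (Matrix.SpecialLinearGroup.map (algebraMap F K)))) <| by
    intro X hX
    rw [← QuotientGroup.eq_one_iff, ← QuotientGroup.mk'_apply, toPSL_eq_one_iff] at hX
    rcases hX with rfl | rfl
    · exact map_one _
    · ext P
      induction P with
      | infty => simp [smul_infty_eq_ite]
      | coe k => simp [smul_some_eq_ite]

variable {F K} {a b c d : F} {h : a * d - b * c = 1}

open Classical in
theorem moebiusHom_infty : moebiusHom F K (toPSL F (mkSL2 a b c d h)) ∞ =
    if algebraMap F K c = 0 then ∞ else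
      ((algebraMap F K a / algebraMap F K c : K) : OnePoint K) :=
  smul_infty_eq_ite (Matrix.SpecialLinearGroup.toGL
    (Matrix.SpecialLinearGroup.map (algebraMap F K) (mkSL2 a b c d h)))

open Classical in
theorem moebiusHom_coe (k : K) : moebiusHom F K (toPSL F (mkSL2 a b c d h)) (k : OnePoint K) =
    if algebraMap F K c * k + algebraMap F K d = 0 then ∞ else
      (((algebraMap F K a * k + algebraMap F K b) / (algebraMap F K c * k + algebraMap F K d) : K) :
        OnePoint K) :=
  smul_some_eq_ite (k := k) (g := Matrix.SpecialLinearGroup.toGL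
    (Matrix.SpecialLinearGroup.map (algebraMap F K) (mkSL2 a b c d h)))

theorem moebiusHom_infty_eq_self_iff :
    moebiusHom F K (toPSL F (mkSL2 a b c d h)) ∞ = ∞ ↔ c = 0 := by
  rw [moebiusHom_infty]
  simp

theorem moebiusHom_coe_eq_self_iff {k : K} :
    moebiusHom F K (toPSL F (mkSL2 a b c d h)) (k : OnePoint K) = k ↔
      algebraMap F K c * k ^ 2 + (algebraMap F K d - algebraMap F K a) * k - algebraMap F K b = 0 := by
  rw [moebiusHom_coe]
  have hd := congrArg (algebraMap F K) h
  simp only [map_sub, map_mul, map_one] at hd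
  split_ifs with h0
  · simp only [infty_ne_coe, false_iff]
    intro h1
    grind
  · rw [coe_eq_coe, div_eq_iff h0]
    grind

/-- A non-parabolic element has exactly two fixed points over a field containing its
eigenvalues. -/
theorem ncard_fixed_moebiusHom {X : SL(2, F)} (h2 : (2 : K) ≠ 0) (ht : X.1.trace ^ 2 ≠ 4)
    (hsq : IsSquare (algebraMap F K (X.1.trace ^ 2 - 4))) :
    {P | moebiusHom F K (toPSL F X) P = P}.ncard = 2 := by
  obtain ⟨a, b, c, d, h, rfl⟩ := exists_eq_mkSL2 X
  rw [trace_mkSL2] at ht hsq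
  by_cases hc : c = 0
  · subst hc
    have hda : algebraMap F K d - algebraMap F K a ≠ 0 := by
      rw [← map_sub]
      intro h0
      rw [map_eq_zero] at h0
      apply ht
      linear_combination (d - a) * h0 + 4 * h
    rw [Set.ncard_eq_two]
    refine ⟨∞, ((algebraMap F K b / (algebraMap F K d - algebraMap F K a) : K) : OnePoint K),
      infty_ne_coe _, ?_⟩
    ext P
    simp only [Set.mem_ofPred_eq, Set.mem_insert_iff, Set.mem_singleton_iff]
    induction P with
    | infty => rw [moebiusHom_infty_eq_self_iff]; simp
    | coe k =>
      rw [moebiusHom_coe_eq_self_iff, coe_eq_coe, eq_div_iff hda]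
      simp only [coe_ne_infty, false_or, map_zero]
      grind
  · obtain ⟨e, he⟩ := hsq
    have hc' : algebraMap F K c ≠ 0 := by simpa using hc
    have hc2 : 2 * algebraMap F K c ≠ 0 := mul_ne_zero h2 hc'
    have he0 : e ≠ 0 := by
      rintro rfl
      rw [mul_zero, map_eq_zero] at he
      exact ht (sub_eq_zero.1 he)
    have hd := congrArg (algebraMap F K) h
    simp only [map_sub, map_mul, map_one, map_pow, map_add, map_ofNat] at hd he
    rw [Set.ncard_eq_two]
    refine ⟨(((algebraMap F K a - algebraMap F K d + e) / (2 * algebraMap F K c) : K) : OnePoint K),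
      (((algebraMap F K a - algebraMap F K d - e) / (2 * algebraMap F K c) : K) : OnePoint K),
      ?_, ?_⟩
    · rw [Ne, coe_eq_coe, div_left_inj' hc2]
      intro h1
      exact mul_ne_zero h2 he0 (by linear_combination h1)
    ext P
    simp only [Set.mem_ofPred_eq, Set.mem_insert_iff, Set.mem_singleton_iff]
    induction P with
    | infty => rw [moebiusHom_infty_eq_self_iff]; simp [hc]
    | coe k =>
      rw [moebiusHom_coe_eq_self_iff, coe_eq_coe, coe_eq_coe, eq_div_iff hc2, eq_div_iff hc2]
      generalize algebraMap F K a = a at *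
      generalize algebraMap F K b = b at *
      generalize algebraMap F K c = c at *
      generalize algebraMap F K d = d at *
      rw [← sub_eq_zero (a := k * (2 * c)), ← sub_eq_zero (a := k * (2 * c)), ← mul_eq_zero]
      have h4 : (k * (2 * c) - (a - d + e)) * (k * (2 * c) - (a - d - e)) =
          2 * 2 * c * (c * k ^ 2 + (d - a) * k - b) := by
        linear_combination he - 4 * hd
      rw [h4, mul_eq_zero, or_iff_right]
      exact mul_ne_zero (mul_ne_zero h2 h2) hc'

end Moebius

section SmallOrders

open Matrix OnePoint

variable {p : ℕ} [Fact p.Prime]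

theorem isSquare_algebraMap_galoisField_two (hp2 : p ≠ 2) (a : ZMod p) :
    IsSquare (algebraMap (ZMod p) (GaloisField p 2) a) := by
  have := Fintype.ofFinite (GaloisField p 2)
  by_cases ha : a = 0
  · simp [ha]
  have hcard : Fintype.card (GaloisField p 2) = p ^ 2 := by
    rw [← Nat.card_eq_fintype_card, GaloisField.card p 2 two_ne_zero]
  have hodd : p % 2 = 1 := (Fact.out : p.Prime).eq_two_or_odd.resolve_left hp2
  have hchar : ringChar (GaloisField p 2) ≠ 2 := by
    rw [ringChar.eq (GaloisField p 2) p]; exact hp2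
  rw [FiniteField.isSquare_iff hchar (by simpa using ha), hcard, ← map_pow]
  obtain ⟨m, rfl⟩ : ∃ m, p = 2 * m + 1 := ⟨p / 2, by omega⟩
  have h1 : (2 * m + 1) ^ 2 / 2 = (2 * m + 1 - 1) * (m + 1) := by
    have : (2 * m + 1) ^ 2 = 2 * ((2 * m + 1 - 1) * (m + 1)) + 1 := by
      rw [Nat.add_sub_cancel]; ring
    omega
  rw [h1, pow_mul, ZMod.pow_card_sub_one_eq_one ha, one_pow, map_one]

theorem toPSL_pow_prime_of_trace_sq {X : SL(2, ZMod p)} (ht : X.1.trace ^ 2 = 4) :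
    toPSL _ X ^ p = 1 := by
  have h1 : (X.1.trace - 2) * (X.1.trace + 2) = 0 := by linear_combination ht
  obtain ⟨e, he, hee⟩ : ∃ e : ZMod p, X.1.trace = 2 * e ∧ e * e = 1 := by
    rcases mul_eq_zero.1 h1 with h | h
    · exact ⟨1, by linear_combination h, by ring⟩
    · exact ⟨-1, by linear_combination h, by ring⟩
  have h2 : (X.1 - e • (1 : Matrix (Fin 2) (Fin 2) (ZMod p))) ^ 2 = 0 := by
    have h3 : (X.1 - e • (1 : Matrix (Fin 2) (Fin 2) (ZMod p))) ^ 2 =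
        X.1 ^ 2 - (2 * e) • X.1 + (e * e) • (1 : Matrix (Fin 2) (Fin 2) (ZMod p)) := by
      rw [sq, sub_mul, mul_sub, mul_sub, ← sq, smul_mul_assoc, mul_smul_comm, smul_mul_smul_comm,
        one_mul, mul_one, one_mul]
      module
    rw [h3, SL2_sq, he, hee]
    simp
  have h4 : (X.1 - e • (1 : Matrix (Fin 2) (Fin 2) (ZMod p))) ^ p = 0 :=
    pow_eq_zero_of_le (Fact.out : p.Prime).two_le h2
  rw [sub_pow_char_of_commute p ((Commute.one_right _).smul_right e), sub_eq_zero, smul_pow,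
    one_pow, ZMod.pow_card] at h4
  rw [← map_pow]
  exact toPSL_eq_one_of_coe_eq_smul (c := e) (by rw [Matrix.SpecialLinearGroup.coe_pow, h4])

/-- If a diagonal element of order at least three and an involution that does not stabilise its
pair of eigenlines, nor fixes one of them, generate a proper subgroup, then the elements of this
subgroup have order at most five, and in particular prime to `p`. -/
theorem orderOf_le_five_of_closure_ne_top (hp2 : p ≠ 2) {a r s t : ZMod p} {ha : a * a⁻¹ - 0 * 0 = 1}
    {hy : r * -r - s * t = 1} (hr : r ≠ 0) (hs : s ≠ 0) (ht : t ≠ 0)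
    (hx : 3 ≤ orderOf (toPSL _ (mkSL2 a 0 0 a⁻¹ ha)))
    (hcl : Subgroup.closure {toPSL _ (mkSL2 a 0 0 a⁻¹ ha), toPSL _ (mkSL2 r s t (-r) hy)} ≠ ⊤)
    {u : PSL(2, ZMod p)}
    (hu : u ∈ Subgroup.closure {toPSL _ (mkSL2 a 0 0 a⁻¹ ha), toPSL _ (mkSL2 r s t (-r) hy)}) :
    orderOf u ≤ 5 ∧ orderOf u ≠ p := by
  set H := Subgroup.closure {toPSL _ (mkSL2 a 0 0 a⁻¹ ha), toPSL _ (mkSL2 r s t (-r) hy)} with hH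
  have hxH : toPSL _ (mkSL2 a 0 0 a⁻¹ ha) ∈ H := Subgroup.subset_closure (by simp)
  have hyH : toPSL _ (mkSL2 r s t (-r) hy) ∈ H := Subgroup.subset_closure (by simp)
  have ha0 : a ≠ 0 := by rintro rfl; simp at ha
  have haa : a⁻¹ - a ≠ 0 := by
    intro h0
    have h1 : a⁻¹ = a := sub_eq_zero.1 h0
    have h2 : toPSL _ (mkSL2 a 0 0 a⁻¹ ha) = 1 := by
      refine toPSL_eq_one_of_coe_eq_smul (c := a) ?_
      rw [coe_mkSL2, h1]; ext i j; fin_cases i <;> fin_cases j <;> simp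
    rw [h2, orderOf_one] at hx
    omega
  have hnp : ∀ u ∈ H, orderOf u ≠ p := by
    intro u hu hup
    rcases eq_top_or_triangular_of_orderOf_eq_prime hu hup with h | ⟨g, hg⟩
    · exact hcl h
    · obtain ⟨v, b, w, d, h, rfl⟩ := exists_eq_mkSL2 g
      have h1 := hg _ hxH
      have h2 := hg _ hyH
      rw [mkSL2_inv, mkSL2_mul, mkSL2_mul, coe_mkSL2] at h1 h2
      simp only [of_apply, cons_val', cons_val_zero, cons_val_one, cons_val_fin_one] at h1 h2
      have h3 : v * w * (a⁻¹ - a) = 0 := by linear_combination h1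
      rcases mul_eq_zero.1 ((mul_eq_zero.1 h3).resolve_right haa) with rfl | rfl
      · have h4 : s * w ^ 2 = 0 := by linear_combination -h2
        have h5 : w ≠ 0 := by rintro rfl; simp at h
        exact mul_ne_zero hs (pow_ne_zero 2 h5) h4
      · have h4 : t * v ^ 2 = 0 := by linear_combination h2
        have h5 : v ≠ 0 := by rintro rfl; simp at h
        exact mul_ne_zero ht (pow_ne_zero 2 h5) h4
  refine ⟨?_, hnp u hu⟩
  let K := GaloisField p 2
  have hK2 : (2 : K) ≠ 0 := by
    apply Ring.two_ne_zero
    rw [ringChar.eq K p]; exact hp2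
  let _ : MulAction H (OnePoint K) :=
    MulAction.compHom _ ((moebiusHom (ZMod p) K).comp H.subtype)
  have hsmul : ∀ (h : H) (P : OnePoint K), h • P = moebiusHom (ZMod p) K h P := fun _ _ => rfl
  have hfin : Finite (OnePoint K) := inferInstanceAs (Finite (Option K))
  have hfix : ∀ h : H, h ≠ 1 → (MulAction.fixedBy (OnePoint K) h).ncard = 2 := by
    rintro ⟨h, hh⟩ h1
    obtain ⟨X, rfl⟩ := toPSL_surjective h
    refine ncard_fixed_moebiusHom hK2 (fun h4 => ?_) (isSquare_algebraMap_galoisField_two hp2 _)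
    refine hnp _ hh (orderOf_eq_prime (toPSL_pow_prime_of_trace_sq h4) fun h5 => h1 ?_)
    exact Subtype.ext h5
  have hpc : moebiusHom (ZMod p) K (toPSL _ (mkSL2 a 0 0 a⁻¹ ha)) ∞ = ∞ :=
    moebiusHom_infty_eq_self_iff.2 rfl
  have hxP : ∀ P : OnePoint K, moebiusHom (ZMod p) K (toPSL _ (mkSL2 a 0 0 a⁻¹ ha)) P = P →
      P = ∞ ∨ P = ((0 : K) : OnePoint K) := by
    intro P hP
    induction P with
    | infty => exact .inl rfl
    | coe k =>
      right
      rw [moebiusHom_coe_eq_self_iff, ← map_sub] at hP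
      simp only [map_zero, zero_mul, zero_add, sub_zero, mul_eq_zero, map_eq_zero] at hP
      rw [hP.resolve_left haa]
  have hx' : 3 ≤ orderOf (⟨_, hxH⟩ : H) := by rwa [Subgroup.orderOf_mk]
  rcases klein_trichotomy hfix hx' with ⟨P, hP, hall⟩ | hinv | hle
  · exfalso
    have h1 := hall ⟨_, hyH⟩
    rw [hsmul] at h1
    rcases hxP P hP with rfl | rfl
    · exact ht (moebiusHom_infty_eq_self_iff.1 h1)
    · rw [moebiusHom_coe_eq_self_iff] at h1
      simp at h1
      exact hs h1
  · exfalso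
    have h1 := hxP _ (hinv ∞ hpc ⟨_, hyH⟩)
    rw [hsmul] at h1
    simp only [moebiusHom_infty] at h1
    simp [ht, hr] at h1
  · have := hle ⟨u, hu⟩
    rwa [Subgroup.orderOf_mk] at this

end SmallOrders

section AlternatingFour

theorem alternatingGroup_four_generators : ∃ i c : alternatingGroup (Fin 4),
    i ^ 2 = 1 ∧ i ≠ 1 ∧ c ^ 3 = 1 ∧ c ≠ 1 ∧ i * (c * i * c⁻¹) = c * i * c⁻¹ * i ∧
    i * (c * i * c⁻¹) ≠ 1 ∧ c * (c * i * c⁻¹) * c⁻¹ = i * (c * i * c⁻¹) ∧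
    ∀ g, ∃ (k l : Fin 2) (m : Fin 3), g = i ^ (k : ℕ) * (c * i * c⁻¹) ^ (l : ℕ) * c ^ (m : ℕ) := by
  refine ⟨⟨Equiv.swap 0 1 * Equiv.swap 2 3, Equiv.Perm.mem_alternatingGroup.2 (by decide)⟩,
    ⟨Equiv.swap 0 1 * Equiv.swap 1 2, Equiv.Perm.mem_alternatingGroup.2 (by decide)⟩, ?_⟩
  decide +kernel

theorem alternatingGroup_four_pow (g : alternatingGroup (Fin 4)) : g ^ 6 = 1 := by
  revert g
  decide +kernel

end AlternatingFour

section Cosets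

open scoped Pointwise

variable {G : Type*} [Group G]

/-- If a finite union of left cosets of `M` is stable under a generating set of `G` and contains
`M`, then it is everything. -/
theorem card_le_of_cosets_stable [Finite G] (M : Subgroup G) {S : Set G} (hS : Subgroup.closure S = ⊤)
    (R : Finset G) (h1 : (1 : G) ∈ R) (hR : ∀ s ∈ S, ∀ r ∈ R, ∃ r' ∈ R, ∃ m ∈ M, s * r = r' * m) :
    Nat.card G ≤ R.card * Nat.card M := by
  classical
  set Q : Set (G ⧸ M) := ↑(R.image (QuotientGroup.mk : G → G ⧸ M)) with hQ
  have h2 : Subgroup.closure S ≤ MulAction.stabilizer G Q := by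
    rw [Subgroup.closure_le]
    intro s hs
    rw [SetLike.mem_coe, MulAction.mem_stabilizer_set_iff_smul_set_subset (Finset.finite_toSet _)]
    rintro _ ⟨_, hq, rfl⟩
    rw [Finset.mem_coe, Finset.mem_image] at hq ⊢
    obtain ⟨r, hr, rfl⟩ := hq
    obtain ⟨r', hr', m, hm, h⟩ := hR s hs r hr
    refine ⟨r', hr', ?_⟩
    change (r' : G ⧸ M) = ((s * r : G) : G ⧸ M)
    rw [h, QuotientGroup.mk_mul_of_mem _ hm]
  have h3 : ∀ q : G ⧸ M, q ∈ R.image (QuotientGroup.mk : G → G ⧸ M) := by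
    intro q
    induction q using QuotientGroup.induction_on with
    | H g =>
      have h4 : g ∈ MulAction.stabilizer G Q := h2 (hS ▸ Subgroup.mem_top g)
      have h5 : ((1 : G) : G ⧸ M) ∈ Q := by
        rw [hQ, Finset.mem_coe]
        exact Finset.mem_image_of_mem _ h1
      have h6 := Set.smul_mem_smul_set (a := g) h5
      rw [MulAction.mem_stabilizer_iff.1 h4] at h6
      have h7 : g • ((1 : G) : G ⧸ M) = (g : G ⧸ M) := by
        change ((g * 1 : G) : G ⧸ M) = g
        rw [mul_one]
      rw [h7, hQ, Finset.mem_coe] at h6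
      exact h6
  rw [Subgroup.card_eq_card_quotient_mul_card_subgroup M]
  refine Nat.mul_le_mul_right _ ?_
  have := Fintype.ofFinite (G ⧸ M)
  rw [Nat.card_eq_fintype_card, ← Finset.card_univ]
  exact (Finset.card_le_card fun q _ => h3 q).trans Finset.card_image_le

variable {M : Subgroup G} {i c e : G}

theorem closure_generators_eq_top (hM : IsCoatom M) (hgen : M = Subgroup.closure {i, c})
    (he : e ∉ M) : Subgroup.closure {i, c, e} = ⊤ := by
  refine hM.2 _ (lt_of_le_of_ne ?_ ?_)
  · rw [hgen]
    exact Subgroup.closure_mono (by grind)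
  · rintro h
    exact he (h ▸ Subgroup.subset_closure (by simp))

theorem card_le_of_octahedral [Finite G] (hM : IsCoatom M) (hgen : M = Subgroup.closure {i, c})
    (h6 : ∀ g ∈ M, g ^ 6 = 1) (hi : i ≠ 1) (hi2 : i ^ 2 = 1) (he : e ^ 2 = i)
    (hce : c * e = e * (i * c ^ 2)) : Nat.card G ≤ 2 * Nat.card M := by
  classical
  have hiM : i ∈ M := hgen ▸ Subgroup.subset_closure (by simp)
  have hcM : c ∈ M := hgen ▸ Subgroup.subset_closure (by simp)
  have heM : e ∉ M := by
    intro h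
    have h1 := h6 e h
    rw [show 6 = 2 * 3 from rfl, pow_mul, he, pow_succ, hi2, one_mul] at h1
    exact hi h1
  refine (card_le_of_cosets_stable M (closure_generators_eq_top hM hgen heM) {1, e} (by simp)
    ?_).trans (Nat.mul_le_mul_right _ Finset.card_le_two)
  simp only [Set.mem_insert_iff, Set.mem_singleton_iff, Finset.mem_insert, Finset.mem_singleton,
    forall_eq_or_imp, forall_eq, exists_eq_or_imp, exists_eq_left]
  refine ⟨⟨.inl ⟨i, hiM, by simp⟩, .inr ⟨i, hiM, by rw [← he]; group⟩⟩,
    ⟨.inl ⟨c, hcM, by simp⟩, .inr ⟨_, mul_mem hiM (pow_mem hcM 2), hce⟩⟩,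
    .inr ⟨1, one_mem _, rfl⟩, .inl ⟨i, hiM, by rw [← he, sq, one_mul]⟩⟩

theorem card_le_of_icosahedral [Finite G] (hM : IsCoatom M) (hgen : M = Subgroup.closure {i, c})
    (h6 : ∀ g ∈ M, g ^ 6 = 1) (hc3 : c ^ 3 = 1) (hc : c ≠ 1) (he : e ^ 5 = 1)
    (hie : i * e = e ^ 4 * i) (hce : c * e = e ^ 4 * c ^ 2)
    (hce2 : c * e ^ 2 = e ^ 2 * (c * i * c⁻¹ * c ^ 2))
    (hce3 : c * e ^ 3 = e * (i * (c * i * c⁻¹) * c)) (hce4 : c * e ^ 4 = e ^ 3 * (c * i * c⁻¹)) :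
    Nat.card G ≤ 5 * Nat.card M := by
  classical
  have hiM : i ∈ M := hgen ▸ Subgroup.subset_closure (by simp)
  have hcM : c ∈ M := hgen ▸ Subgroup.subset_closure (by simp)
  have hjM : c * i * c⁻¹ ∈ M := mul_mem (mul_mem hcM hiM) (inv_mem hcM)
  have heM : e ∉ M := by
    intro h
    have h1 := h6 e h
    rw [pow_succ, he, one_mul] at h1
    rw [h1, one_pow, one_mul, mul_one] at hce
    rw [pow_succ, ← hce, ← sq, ← hce] at hc3
    exact hc hc3
  have hpow : ∀ n : ℕ, i * e ^ n = (e ^ n) ^ 4 * i := by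
    intro n
    induction n with
    | zero => simp
    | succ n ih =>
      rw [pow_succ, ← mul_assoc, ih, mul_assoc, hie, ← mul_assoc, ((Commute.refl e).pow_left n).mul_pow]
  have hmod : ∀ n : ℕ, e ^ n = e ^ (n % 5) := fun n => pow_eq_pow_mod n he
  refine (card_le_of_cosets_stable M (closure_generators_eq_top hM hgen heM)
    ((Finset.range 5).image (e ^ ·)) (Finset.mem_image.2 ⟨0, by simp⟩)
    ?_).trans (Nat.mul_le_mul_right _ (Finset.card_image_le.trans (by simp)))
  have hmem : ∀ n : ℕ, e ^ n ∈ (Finset.range 5).image (e ^ ·) := by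
    intro n
    rw [hmod, Finset.mem_image]
    exact ⟨n % 5, Finset.mem_range.2 (Nat.mod_lt _ (by norm_num)), rfl⟩
  intro s hs r hr
  obtain ⟨n, hn, rfl⟩ := Finset.mem_image.1 hr
  rw [Finset.mem_range] at hn
  rcases hs with rfl | rfl | rfl
  · exact ⟨_, hmem (n * 4), _, hiM, by rw [hpow, ← pow_mul]⟩
  · interval_cases n
    · exact ⟨_, hmem 0, _, hcM, by simp⟩
    · exact ⟨_, hmem 4, _, pow_mem hcM 2, by rw [pow_one, hce]⟩
    · exact ⟨_, hmem 2, _, mul_mem hjM (pow_mem hcM 2), hce2⟩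
    · exact ⟨_, hmem 1, _, mul_mem (mul_mem hiM hjM) hcM, by rw [hce3, pow_one]⟩
    · exact ⟨_, hmem 3, _, hjM, hce4⟩
  · exact ⟨_, hmem (n + 1), 1, one_mem _, by rw [mul_one, pow_succ']⟩

end Cosets

section Quaternion

open Matrix

variable {F : Type*} [Field F]

/-- Two elements of `SL₂(F)` that generate a quaternion group. -/
structure IsQuaternionPair (I J : SL(2, F)) : Prop where
  trace_left : I.1.trace = 0
  trace_right : J.1.trace = 0
  trace_mul : (I * J).1.trace = 0

namespace IsQuaternionPair

theorem sq_eq_neg_one {X : SL(2, F)} (h : X.1.trace = 0) : X * X = -1 := by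
  apply Subtype.ext
  rw [← sq, Matrix.SpecialLinearGroup.coe_pow, SL2_sq, h]
  simp

theorem inv_eq_neg {X : SL(2, F)} (h : X.1.trace = 0) : X⁻¹ = -X := by
  rw [inv_eq_iff_mul_eq_one, mul_neg, sq_eq_neg_one h, neg_neg]

variable {I J : SL(2, F)} (h : IsQuaternionPair I J)
include h

theorem mul_comm_neg : J * I = -(I * J) := by
  rw [← inv_eq_neg h.trace_mul, _root_.mul_inv_rev, inv_eq_neg h.trace_left,
    inv_eq_neg h.trace_right, neg_mul_neg]

/-- The quaternion basis attached to a quaternion pair. -/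
def basis : QuaternionAlgebra.Basis (Matrix (Fin 2) (Fin 2) F) (-1 : F) 0 (-1) where
  i := I.1
  j := J.1
  k := I.1 * J.1
  i_mul_i := by
    have := congrArg Subtype.val (sq_eq_neg_one h.trace_left)
    simpa using this
  j_mul_j := by
    have := congrArg Subtype.val (sq_eq_neg_one h.trace_right)
    simpa using this
  i_mul_j := rfl
  j_mul_i := by
    have := congrArg Subtype.val h.mul_comm_neg
    simpa using this

theorem lift_mk (x y z w : F) : h.basis.lift ⟨x, y, z, w⟩ =
    x • (1 : Matrix (Fin 2) (Fin 2) F) + y • I.1 + z • J.1 + w • (I * J).1 := by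
  rw [QuaternionAlgebra.Basis.lift, Algebra.algebraMap_eq_smul_one]
  rfl

theorem det_lift (x y z w : F) :
    (h.basis.lift ⟨x, y, z, w⟩).det = x ^ 2 + y ^ 2 + z ^ 2 + w ^ 2 := by
  have h1 : (h.basis.lift ⟨x, y, z, w⟩).adjugate = h.basis.lift ⟨x, -y, -z, -w⟩ := by
    rw [lift_mk, lift_mk]
    have h1 := h.trace_left
    have h2 := h.trace_right
    have h3 := h.trace_mul
    rw [trace_fin_two] at h1 h2 h3
    generalize (I * J).1 = K at *
    generalize I.1 = I at *
    generalize J.1 = J at *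
    rw [adjugate_fin_two]
    ext i j
    fin_cases i <;> fin_cases j <;> simp <;> grind
  have h2 := mul_adjugate (h.basis.lift ⟨x, y, z, w⟩)
  rw [h1, ← QuaternionAlgebra.Basis.lift_mul] at h2
  have h3 : (⟨x, y, z, w⟩ : QuaternionAlgebra F (-1) 0 (-1)) * ⟨x, -y, -z, -w⟩ =
      ⟨x ^ 2 + y ^ 2 + z ^ 2 + w ^ 2, 0, 0, 0⟩ := by
    ext <;> simp <;> ring
  rw [h3, lift_mk] at h2
  have h4 := congrFun₂ h2 0 0
  simpa using h4.symm

/-- The element of `SL₂(F)` attached to a unit quaternion. -/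
def unit (x y z w : F) (hn : x ^ 2 + y ^ 2 + z ^ 2 + w ^ 2 = 1) : SL(2, F) :=
  ⟨h.basis.lift ⟨x, y, z, w⟩, by rw [det_lift, hn]⟩

theorem unit_mul {x y z w x' y' z' w' : F} (hn : x ^ 2 + y ^ 2 + z ^ 2 + w ^ 2 = 1)
    (hn' : x' ^ 2 + y' ^ 2 + z' ^ 2 + w' ^ 2 = 1) :
    h.unit x y z w hn * h.unit x' y' z' w' hn' =
      h.unit (x * x' - y * y' - z * z' - w * w') (x * y' + y * x' + z * w' - w * z')
        (x * z' - y * w' + z * x' + w * y') (x * w' + y * z' - z * y' + w * x')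
        (by linear_combination (x' ^ 2 + y' ^ 2 + z' ^ 2 + w' ^ 2) * hn + hn') := by
  apply Subtype.ext
  rw [Matrix.SpecialLinearGroup.coe_mul, unit, unit, ← QuaternionAlgebra.Basis.lift_mul, unit]
  congr 1
  ext <;> simp <;> ring

theorem unit_congr {x y z w x' y' z' w' : F} {hn : x ^ 2 + y ^ 2 + z ^ 2 + w ^ 2 = 1}
    {hn' : x' ^ 2 + y' ^ 2 + z' ^ 2 + w' ^ 2 = 1} (hx : x = x') (hy : y = y') (hz : z = z')
    (hw : w = w') : h.unit x y z w hn = h.unit x' y' z' w' hn' := by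
  subst hx hy hz hw
  rfl

theorem neg_unit {x y z w : F} (hn : x ^ 2 + y ^ 2 + z ^ 2 + w ^ 2 = 1) :
    -h.unit x y z w hn = h.unit (-x) (-y) (-z) (-w) (by linear_combination hn) := by
  apply Subtype.ext
  change -h.basis.lift _ = h.basis.lift _
  simp only [lift_mk]
  module

theorem one_eq_unit : 1 = h.unit 1 0 0 0 (by ring) := by
  apply Subtype.ext
  simp only [unit, lift_mk, Matrix.SpecialLinearGroup.coe_one]
  module

theorem left_eq_unit : I = h.unit 0 1 0 0 (by ring) := by
  apply Subtype.ext
  simp only [unit, lift_mk]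
  module

theorem right_eq_unit : J = h.unit 0 0 1 0 (by ring) := by
  apply Subtype.ext
  simp only [unit, lift_mk]
  module

theorem mul_eq_unit : I * J = h.unit 0 0 0 1 (by ring) := by
  apply Subtype.ext
  simp only [unit, lift_mk]
  module

section

variable {x y z w x' y' z' w' x₁ y₁ z₁ w₁ x₂ y₂ z₂ w₂ : F}
  {hn : x ^ 2 + y ^ 2 + z ^ 2 + w ^ 2 = 1} {hn' : x' ^ 2 + y' ^ 2 + z' ^ 2 + w' ^ 2 = 1}
  {hn₁ : x₁ ^ 2 + y₁ ^ 2 + z₁ ^ 2 + w₁ ^ 2 = 1} {hn₂ : x₂ ^ 2 + y₂ ^ 2 + z₂ ^ 2 + w₂ ^ 2 = 1}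

theorem toPSL_unit_mul (hx : x * x' - y * y' - z * z' - w * w' = x₁)
    (hy : x * y' + y * x' + z * w' - w * z' = y₁) (hz : x * z' - y * w' + z * x' + w * y' = z₁)
    (hw : x * w' + y * z' - z * y' + w * x' = w₁) :
    toPSL F (h.unit x y z w hn) * toPSL F (h.unit x' y' z' w' hn') =
      toPSL F (h.unit x₁ y₁ z₁ w₁ hn₁) := by
  rw [← map_mul, h.unit_mul, h.unit_congr hx hy hz hw]

theorem toPSL_unit_mul_eq
    (hx : x * x' - y * y' - z * z' - w * w' = x₁ * x₂ - y₁ * y₂ - z₁ * z₂ - w₁ * w₂)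
    (hy : x * y' + y * x' + z * w' - w * z' = x₁ * y₂ + y₁ * x₂ + z₁ * w₂ - w₁ * z₂)
    (hz : x * z' - y * w' + z * x' + w * y' = x₁ * z₂ - y₁ * w₂ + z₁ * x₂ + w₁ * y₂)
    (hw : x * w' + y * z' - z * y' + w * x' = x₁ * w₂ + y₁ * z₂ - z₁ * y₂ + w₁ * x₂) :
    toPSL F (h.unit x y z w hn) * toPSL F (h.unit x' y' z' w' hn') =
      toPSL F (h.unit x₁ y₁ z₁ w₁ hn₁) * toPSL F (h.unit x₂ y₂ z₂ w₂ hn₂) := by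
  rw [← map_mul, ← map_mul, h.unit_mul, h.unit_mul, h.unit_congr hx hy hz hw]

theorem toPSL_unit_mul_eq_neg
    (hx : x * x' - y * y' - z * z' - w * w' = -(x₁ * x₂ - y₁ * y₂ - z₁ * z₂ - w₁ * w₂))
    (hy : x * y' + y * x' + z * w' - w * z' = -(x₁ * y₂ + y₁ * x₂ + z₁ * w₂ - w₁ * z₂))
    (hz : x * z' - y * w' + z * x' + w * y' = -(x₁ * z₂ - y₁ * w₂ + z₁ * x₂ + w₁ * y₂))
    (hw : x * w' + y * z' - z * y' + w * x' = -(x₁ * w₂ + y₁ * z₂ - z₁ * y₂ + w₁ * x₂)) :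
    toPSL F (h.unit x y z w hn) * toPSL F (h.unit x' y' z' w' hn') =
      toPSL F (h.unit x₁ y₁ z₁ w₁ hn₁) * toPSL F (h.unit x₂ y₂ z₂ w₂ hn₂) := by
  rw [← map_mul, ← map_mul, ← toPSL_neg (h.unit x₁ y₁ z₁ w₁ hn₁ * _), h.unit_mul, h.unit_mul,
    h.neg_unit, h.unit_congr hx hy hz hw]

end

theorem toPSL_eq_one_of_commute (h2 : (2 : F) ≠ 0) {Z : SL(2, F)} (hI : Z * I = I * Z)
    (hJ : Z * J = J * Z) : toPSL F Z = 1 := by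
  have h1 := h.trace_left
  have h2' := h.trace_right
  have h3 := h.trace_mul
  obtain ⟨a, b, c, a', hI1, rfl⟩ := exists_eq_mkSL2 I
  obtain ⟨d, e, f, d', hJ1, rfl⟩ := exists_eq_mkSL2 J
  obtain ⟨r, y, z, s, hZ1, rfl⟩ := exists_eq_mkSL2 Z
  rw [trace_mkSL2] at h1 h2'
  rw [mkSL2_mul, trace_mkSL2] at h3
  obtain rfl : a' = -a := by linear_combination h1
  obtain rfl : d' = -d := by linear_combination h2'
  rw [mkSL2_mul, mkSL2_mul] at hI hJ
  have hI' := congrArg Subtype.val hI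
  have hJ' := congrArg Subtype.val hJ
  rw [coe_mkSL2, coe_mkSL2] at hI' hJ'
  have i00 := congrFun₂ hI' 0 0
  have i01 := congrFun₂ hI' 0 1
  have i10 := congrFun₂ hI' 1 0
  have j00 := congrFun₂ hJ' 0 0
  have j01 := congrFun₂ hJ' 0 1
  have j10 := congrFun₂ hJ' 1 0
  simp at i00 i01 i10 j00 j01 j10
  have hl : ∀ {a b c : F}, a * -a - b * c = 1 → y * c = b * z → (r - s) * b = 2 * (a * y) →
      (r - s) * c = 2 * (a * z) → ∃ l, r - s = 2 * (l * a) ∧ y = l * b ∧ z = l * c := by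
    intro a b c h0 h1 h2 h3
    refine ⟨-((r - s) / 2 * a + b * z), ?_, ?_, ?_⟩
    · field_simp
      linear_combination -(r - s) * h0 - b * h3
    · field_simp
      linear_combination -2 * y * h0 + a * h2 - 2 * b * h1
    · field_simp
      linear_combination -2 * z * h0 + a * h3
  obtain ⟨l, hr1, hy1, hz1⟩ := hl hI1 (by linear_combination i00) (by linear_combination i01)
    (by linear_combination -i10)
  obtain ⟨m, hr2, hy2, hz2⟩ := hl hJ1 (by linear_combination j00) (by linear_combination j01)
    (by linear_combination -j10)
  have hl0 : l = 0 := by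
    have h5 : 2 * (l * l) * 2 = 0 := by
      linear_combination -4 * l * l * hI1 - 2 * (l * a * (hr2 - hr1) + l * b * (hz2 - hz1) +
        l * c * (hy2 - hy1) + l * m * h3)
    simpa [h2] using h5
  subst hl0
  refine toPSL_eq_one_of_coe_eq_smul (c := r) ?_
  rw [coe_mkSL2, hy1, hz1, show s = r by linear_combination -hr1]
  ext i j
  fin_cases i <;> fin_cases j <;> simp

end IsQuaternionPair

theorem sum_sq_eq_one {u : F} (hu : u * 2 = 1) : u ^ 2 + u ^ 2 + u ^ 2 + u ^ 2 = 1 := by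
  linear_combination (u * 2 + 1) * hu

/-- A subgroup of `PSL₂(F)` satisfying the relations of `A₄` lifts to the group of Hurwitz units. -/
theorem exists_isQuaternionPair {u : F} (hu : u * 2 = 1) {i c : PSL(2, F)} (hi : i ≠ 1) (hi2 : i ^ 2 = 1)
    (hcomm : i * (c * i * c⁻¹) = c * i * c⁻¹ * i) (hij : i * (c * i * c⁻¹) ≠ 1)
    (hk : c * (c * i * c⁻¹) * c⁻¹ = i * (c * i * c⁻¹)) :
    ∃ (I J : SL(2, F)) (h : IsQuaternionPair I J), toPSL F (h.unit 0 1 0 0 (by ring)) = i ∧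
      toPSL F (h.unit 0 0 1 0 (by ring)) = c * i * c⁻¹ ∧
      toPSL F (h.unit _ _ _ _ (sum_sq_eq_one hu)) = c := by
  have h2 : (2 : F) ≠ 0 := right_ne_zero_of_mul_eq_one hu
  obtain ⟨C, rfl⟩ := toPSL_surjective c
  have key : ∀ I : SL(2, F), toPSL F I = i → C * (C * I * C⁻¹) * C⁻¹ = I * (C * I * C⁻¹) →
      ∃ (I J : SL(2, F)) (h : IsQuaternionPair I J), toPSL F (h.unit 0 1 0 0 (by ring)) = i ∧
        toPSL F (h.unit 0 0 1 0 (by ring)) = toPSL F C * i * (toPSL F C)⁻¹ ∧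
        toPSL F (h.unit _ _ _ _ (sum_sq_eq_one hu)) = toPSL F C := by
    rintro I rfl hK
    have hj : toPSL F (C * I * C⁻¹) = toPSL F C * toPSL F I * (toPSL F C)⁻¹ := by
      rw [map_mul, map_mul, map_inv]
    have h : IsQuaternionPair I (C * I * C⁻¹) := by
      refine ⟨trace_eq_zero_of_toPSL_sq hi hi2, trace_eq_zero_of_toPSL_sq ?_ ?_,
        trace_eq_zero_of_toPSL_sq ?_ ?_⟩
      · rw [hj, Ne, mul_inv_eq_one, mul_eq_left]
        exact hi
      · rw [hj, conj_pow, hi2, mul_one, mul_inv_cancel]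
      · rw [map_mul, hj]
        exact hij
      · have h3 : Commute (toPSL F I) (toPSL F C * toPSL F I * (toPSL F C)⁻¹) := hcomm
        rw [map_mul, hj, h3.mul_pow, conj_pow, hi2, mul_one, mul_inv_cancel, mul_one]
    refine ⟨I, _, h, by rw [← h.left_eq_unit], by rw [← h.right_eq_unit, hj], ?_⟩
    have hW : ∀ {x y z w : F} {hn hn'}, h.unit _ _ _ _ (sum_sq_eq_one hu) * h.unit x y z w hn
        = h.unit x w y z hn' * h.unit _ _ _ _ (sum_sq_eq_one hu) := by
      intro x y z w hn hn'
      rw [h.unit_mul, h.unit_mul]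
      apply h.unit_congr <;> ring
    set W := h.unit _ _ _ _ (sum_sq_eq_one hu)
    have hWI : W * I = C * I * C⁻¹ * W := by
      conv_lhs => rw [h.left_eq_unit]
      conv_rhs => rw [h.right_eq_unit]
      exact hW
    have hWJ : W * (C * I * C⁻¹) = I * (C * I * C⁻¹) * W := by
      rw [h.mul_eq_unit]
      conv_lhs => rw [h.right_eq_unit]
      exact hW
    have h5 := h.toPSL_eq_one_of_commute h2 (Z := W⁻¹ * C) ?_ ?_
    · rwa [map_mul, map_inv, inv_mul_eq_one] at h5
    · rw [mul_assoc, inv_mul_eq_iff_eq_mul, ← mul_assoc, ← mul_assoc, hWI]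
      group
    · rw [mul_assoc, inv_mul_eq_iff_eq_mul, ← mul_assoc W, hWJ, ← hK]
      group
  obtain ⟨I, rfl⟩ := toPSL_surjective i
  have h3 : toPSL F (C * (C * I * C⁻¹) * C⁻¹) = toPSL F (I * (C * I * C⁻¹)) := by
    simpa only [map_mul, map_inv] using hk
  rcases toPSL_eq_iff.1 h3 with h3 | h3
  · exact key I rfl h3
  · refine key (-I) (toPSL_neg I) ?_
    simp only [mul_neg, neg_mul, neg_neg, h3]

theorem exists_octahedral {u : F} (hu : u * 2 = 1) {t : F} (ht : t ^ 2 = 2) {i c : PSL(2, F)} (hi : i ≠ 1)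
    (hi2 : i ^ 2 = 1) (hcomm : i * (c * i * c⁻¹) = c * i * c⁻¹ * i) (hij : i * (c * i * c⁻¹) ≠ 1)
    (hk : c * (c * i * c⁻¹) * c⁻¹ = i * (c * i * c⁻¹)) :
    ∃ e : PSL(2, F), e ^ 2 = i ∧ c * e = e * (i * c ^ 2) := by
  obtain ⟨I, J, h, hI, -, hC⟩ := exists_isQuaternionPair hu hi hi2 hcomm hij hk
  have hC2 : c ^ 2 = toPSL F (h.unit (-u) u u u (by grind)) := by
    rw [← hC, sq]
    apply h.toPSL_unit_mul <;> clear * - hu ht <;> grind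
  have hIC2 : i * c ^ 2 = toPSL F (h.unit (-u) (-u) (-u) u (by grind)) := by
    rw [hC2, ← hI]
    apply h.toPSL_unit_mul <;> clear * - hu ht <;> grind
  refine ⟨toPSL _ (h.unit (t * u) (t * u) 0 0 (by grind)), ?_, ?_⟩
  · rw [← hI, sq]
    apply h.toPSL_unit_mul <;> clear * - hu ht <;> grind
  · rw [hIC2, ← hC]
    apply h.toPSL_unit_mul_eq_neg <;> clear * - hu ht <;> grind

set_option maxHeartbeats 1600000 in
theorem exists_icosahedral {u : F} (hu : u * 2 = 1) {t : F} (ht : t ^ 2 = t + 1) {i c : PSL(2, F)}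
    (hi : i ≠ 1) (hi2 : i ^ 2 = 1) (hcomm : i * (c * i * c⁻¹) = c * i * c⁻¹ * i)
    (hij : i * (c * i * c⁻¹) ≠ 1) (hk : c * (c * i * c⁻¹) * c⁻¹ = i * (c * i * c⁻¹)) :
    ∃ e : PSL(2, F), e ^ 5 = 1 ∧ i * e = e ^ 4 * i ∧ c * e = e ^ 4 * c ^ 2 ∧
      c * e ^ 2 = e ^ 2 * (c * i * c⁻¹ * c ^ 2) ∧ c * e ^ 3 = e * (i * (c * i * c⁻¹) * c) ∧
      c * e ^ 4 = e ^ 3 * (c * i * c⁻¹) := by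
  obtain ⟨I, J, h, hI, hJ, hC⟩ := exists_isQuaternionPair hu hi hi2 hcomm hij hk
  generalize c * i * c⁻¹ = j at *
  have hC2 : c ^ 2 = toPSL F (h.unit (-u) u u u (by grind)) := by
    rw [← hC, sq]
    apply h.toPSL_unit_mul <;> clear * - hu ht <;> grind
  have hjC2 : j * c ^ 2 = toPSL F (h.unit (-u) u (-u) (-u) (by grind)) := by
    rw [hC2, ← hJ]
    apply h.toPSL_unit_mul <;> clear * - hu ht <;> grind
  have hK : i * j = toPSL F (h.unit 0 0 0 1 (by grind)) := by
    rw [← hI, ← hJ]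
    apply h.toPSL_unit_mul <;> clear * - hu ht <;> grind
  have hKC : i * j * c = toPSL F (h.unit (-u) (-u) u u (by grind)) := by
    rw [hK, ← hC]
    apply h.toPSL_unit_mul <;> clear * - hu ht <;> grind
  obtain ⟨e, he⟩ : ∃ e, e = toPSL F (h.unit (t * u) 0 u ((t - 1) * u) (by grind)) := ⟨_, rfl⟩
  have he2 : e ^ 2 = toPSL F (h.unit ((t - 1) * u) 0 (t * u) u (by grind)) := by
    rw [he, sq]
    apply h.toPSL_unit_mul <;> clear * - hu ht <;> grind
  have he3 : e ^ 3 = toPSL F (h.unit ((1 - t) * u) 0 (t * u) u (by grind)) := by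
    rw [pow_succ, he2, he]
    apply h.toPSL_unit_mul <;> clear * - hu ht <;> grind
  have he4 : e ^ 4 = toPSL F (h.unit (-t * u) 0 u ((t - 1) * u) (by grind)) := by
    rw [pow_succ, he3, he]
    apply h.toPSL_unit_mul <;> clear * - hu ht <;> grind
  refine ⟨e, ?_, ?_, ?_, ?_, ?_, ?_⟩
  · rw [pow_succ, he4, he, ← map_one (toPSL F), h.one_eq_unit, ← toPSL_neg (h.unit 1 0 0 0 _),
      h.neg_unit]
    apply h.toPSL_unit_mul <;> clear * - hu ht <;> grind
  · rw [he4, he, ← hI]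
    apply h.toPSL_unit_mul_eq_neg <;> clear * - hu ht <;> grind
  · rw [he4, hC2, he, ← hC]
    apply h.toPSL_unit_mul_eq_neg <;> clear * - hu ht <;> grind
  · rw [hjC2, he2, ← hC]
    apply h.toPSL_unit_mul_eq_neg <;> clear * - hu ht <;> grind
  · rw [hKC, he3, he, ← hC]
    apply h.toPSL_unit_mul_eq <;> clear * - hu ht <;> grind
  · rw [he4, he3, ← hJ, ← hC]
    apply h.toPSL_unit_mul_eq <;> clear * - hu ht <;> grind

end Quaternion

section NoAlternatingFour

variable {p : ℕ} [Fact p.Prime]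

theorem card_PSL_two_gt (hp : 7 ≤ p) : 60 < Nat.card PSL(2, ZMod p) := by
  have hp0 : 0 < p := by omega
  have h1 : Nat.card (ZMod p × ZMod p × (ZMod p)ˣ) ≤ Nat.card SL(2, ZMod p) := by
    refine Nat.card_le_card_of_injective (fun q => mkSL2 q.1 ((q.1 * q.2.1 - 1) * q.2.2⁻¹) q.2.2 q.2.1
      (by rw [mul_assoc, Units.inv_mul, mul_one]; ring)) ?_
    rintro ⟨a, d, c⟩ ⟨a', d', c'⟩ h
    simp only [mkSL2_inj] at h
    simp only [Prod.mk.injEq]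
    exact ⟨h.1, h.2.2.2, Units.ext h.2.2.1⟩
  have h2 : Nat.card (ZMod p × ZMod p × (ZMod p)ˣ) = p * (p * (p - 1)) := by
    rw [Nat.card_prod, Nat.card_prod, Nat.card_zmod, Nat.card_eq_fintype_card, ZMod.card_units]
  have h3 : Nat.card SL(2, ZMod p) ≤ 2 * Nat.card PSL(2, ZMod p) := by
    rw [Subgroup.card_eq_card_quotient_mul_card_subgroup (Subgroup.center SL(2, ZMod p)), mul_comm]
    refine Nat.mul_le_mul_right _ ?_
    have h4 : (Subgroup.center SL(2, ZMod p) : Set SL(2, ZMod p)) ⊆ {1, -1} := by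
      intro X hX
      have h5 : toPSL _ X = 1 := (QuotientGroup.eq_one_iff X).2 hX
      simpa using toPSL_eq_one_iff.1 h5
    exact (Set.ncard_le_ncard h4 (Set.toFinite _)).trans ((Set.ncard_insert_le _ _).trans (by simp))
  have h5 : 7 * (7 * 6) ≤ p * (p * (p - 1)) :=
    Nat.mul_le_mul hp (Nat.mul_le_mul hp (by omega))
  omega

theorem exists_generators_of_isAlternatingFour {G : Type*} [Group G] {M : Subgroup G}
    (hM : Nonempty (M ≃* alternatingGroup (Fin 4))) :
    Nat.card M = 12 ∧ (∀ g ∈ M, g ^ 6 = 1) ∧ ∃ i c : G, M = Subgroup.closure {i, c} ∧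
      i ^ 2 = 1 ∧ i ≠ 1 ∧ c ^ 3 = 1 ∧ c ≠ 1 ∧ i * (c * i * c⁻¹) = c * i * c⁻¹ * i ∧
      i * (c * i * c⁻¹) ≠ 1 ∧ c * (c * i * c⁻¹) * c⁻¹ = i * (c * i * c⁻¹) := by
  obtain ⟨f⟩ := hM
  refine ⟨?_, ?_, ?_⟩
  · rw [Nat.card_congr f.toEquiv, nat_card_alternatingGroup, Nat.card_fin]
    rfl
  · intro g hg
    have h1 : f ((⟨g, hg⟩ : M) ^ 6) = f 1 := by rw [map_pow, alternatingGroup_four_pow, map_one]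
    exact congrArg Subtype.val (f.injective h1)
  · obtain ⟨i, c, h1, h2, h3, h4, h5, h6, h7, h8⟩ := alternatingGroup_four_generators
    have hinj : Function.Injective (M.subtype.comp f.symm.toMonoidHom) :=
      M.subtype_injective.comp f.symm.injective
    set φ := M.subtype.comp f.symm.toMonoidHom with hφ
    refine ⟨φ i, φ c, ?_, ?_, ?_, ?_, ?_, ?_, ?_, ?_⟩
    · apply le_antisymm
      · intro g hg
        obtain ⟨k, l, m, h⟩ := h8 (f ⟨g, hg⟩)
        have h9 : g = φ (f ⟨g, hg⟩) := by simp [hφ]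
        rw [h9, h]
        simp only [map_mul, map_pow, map_inv]
        have hi : φ i ∈ Subgroup.closure {φ i, φ c} := Subgroup.subset_closure (by simp)
        have hc : φ c ∈ Subgroup.closure {φ i, φ c} := Subgroup.subset_closure (by simp)
        exact mul_mem (mul_mem (pow_mem hi _) (pow_mem (mul_mem (mul_mem hc hi) (inv_mem hc)) _))
          (pow_mem hc _)
      · rw [Subgroup.closure_le]
        rintro _ (rfl | rfl)
        · exact (f.symm i).2
        · exact (f.symm c).2
    all_goals simp only [← map_mul, ← map_pow, ← map_inv, Ne, map_eq_one_iff φ hinj, hinj.eq_iff]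
    all_goals assumption

theorem sq_ne_two_of_maximal_alternatingFour (hp : 7 ≤ p)
    (hA4 : HasMaximalSubgroupIsoTo PSL(2, ZMod p) (alternatingGroup (Fin 4)))
    (t : ZMod p) : t ^ 2 ≠ 2 := by
  intro ht
  obtain ⟨M, hM, hf⟩ := hA4
  obtain ⟨hcard, h6, i, c, hgen, hi2, hi, hc3, hc, hcomm, hij, hk⟩ :=
    exists_generators_of_isAlternatingFour hf
  have h2 : (2 : ZMod p) ≠ 0 := Ring.two_ne_zero (by rw [ringChar.eq (ZMod p) p]; omega)
  obtain ⟨e, he, hce⟩ := exists_octahedral (inv_mul_cancel₀ h2) ht hi hi2 hcomm hij hk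
  have h24 := card_le_of_octahedral hM hgen h6 hi hi2 he hce
  have := card_PSL_two_gt hp
  omega

theorem sq_ne_add_one_of_maximal_alternatingFour (hp : 7 ≤ p)
    (hA4 : HasMaximalSubgroupIsoTo PSL(2, ZMod p) (alternatingGroup (Fin 4)))
    (t : ZMod p) : t ^ 2 ≠ t + 1 := by
  intro ht
  obtain ⟨M, hM, hf⟩ := hA4
  obtain ⟨hcard, h6, i, c, hgen, hi2, hi, hc3, hc, hcomm, hij, hk⟩ :=
    exists_generators_of_isAlternatingFour hf
  have h2 : (2 : ZMod p) ≠ 0 := Ring.two_ne_zero (by rw [ringChar.eq (ZMod p) p]; omega)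
  obtain ⟨e, he, hie, hce, hce2, hce3, hce4⟩ :=
    exists_icosahedral (inv_mul_cancel₀ h2) ht hi hi2 hcomm hij hk
  have h60 := card_le_of_icosahedral hM hgen h6 hc3 hc he hie hce hce2 hce3 hce4
  have := card_PSL_two_gt hp
  omega

end NoAlternatingFour

section Count

open Matrix

variable {p : ℕ} [Fact p.Prime]

/-- An element of `PSL₂(p)` whose order is at least three and divides `p - 1` is diagonalisable. -/
theorem exists_conj_diagonal {X : SL(2, ZMod p)} (hX : 2 < orderOf (toPSL _ X))
    (hd : orderOf (toPSL _ X) ∣ p - 1) :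
    ∃ (g : SL(2, ZMod p)) (a : ZMod p) (ha : a * a⁻¹ - 0 * 0 = 1),
      g⁻¹ * X * g = mkSL2 a 0 0 a⁻¹ ha := by
  have hp1 : 1 < p := (Fact.out : p.Prime).one_lt
  have hp : p - 1 + 1 = p := Nat.sub_add_cancel hp1.le
  have h2 : (2 : ZMod p) ≠ 0 := by
    refine Ring.two_ne_zero ?_
    rw [ringChar.eq (ZMod p) p]
    have := Nat.le_of_dvd (by omega) hd
    omega
  have ht : X.1.trace ≠ 0 := by
    intro h
    have := Nat.le_of_dvd two_pos (orderOf_dvd_of_pow_eq_one (toPSL_sq_eq_one h))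
    omega
  have hpow : X.1 ^ p = X.1 := by
    have h3 := orderOf_dvd_iff_pow_eq_one.1 hd
    have h4 : X.1 ^ (p - 1) * X.1 = X.1 ^ p := by rw [← pow_succ, hp]
    rw [← map_pow, toPSL_eq_one_iff] at h3
    have h6 := Matrix.SpecialLinearGroup.coe_pow X (p - 1)
    rcases h3 with h3 | h3 <;> rw [h3] at h6
    · rw [← h4, ← h6]
      exact one_mul _
    · have h5 := ZMod.trace_pow_card X.1
      rw [← h4, ← h6, ZMod.pow_card] at h5
      simp only [Matrix.SpecialLinearGroup.coe_neg, Matrix.SpecialLinearGroup.coe_one, neg_mul,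
        one_mul, trace_neg] at h5
      have h7 : 2 * X.1.trace = 0 := by linear_combination -h5
      rw [mul_eq_zero, or_iff_left ht] at h7
      exact absurd h7 h2
  obtain ⟨e, he⟩ : ∃ e, e ^ 2 - X.1.trace * e + 1 = 0 := by
    have h3 : minpoly (ZMod p) X.1 ∣ Polynomial.X ^ p - Polynomial.X :=
      minpoly.dvd _ _ (by simp [hpow])
    have h4 := (GaloisField.splits_zmod_X_pow_sub_X p).of_dvd
      (FiniteField.X_pow_card_sub_X_ne_zero (ZMod p) hp1) h3
    obtain ⟨e, he⟩ := h4.exists_eval_eq_zero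
      (minpoly.degree_pos (Algebra.IsIntegral.isIntegral X.1)).ne'
    refine ⟨e, ?_⟩
    have h5 := Polynomial.eval_eq_zero_of_dvd_of_eval_eq_zero (Matrix.minpoly_dvd_charpoly X.1) he
    rw [Matrix.charpoly_fin_two, X.2] at h5
    simpa using h5
  obtain ⟨g, f, e', hf, hg⟩ := exists_conj_upperTriangular he
  have htr : X.1.trace = e + e' := by
    have h3 : X = g * mkSL2 e f 0 e' hf * g⁻¹ := by rw [← hg]; group
    have h4 := trace_mkSL2 (h := hf)
    have h5 : (g.1 * (mkSL2 e f 0 e' hf).1 * (g⁻¹).1).trace = (mkSL2 e f 0 e' hf).1.trace := by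
      rw [trace_mul_cycle, ← Matrix.SpecialLinearGroup.coe_mul, inv_mul_cancel,
        Matrix.SpecialLinearGroup.coe_one, one_mul]
    rw [← h4, ← h5, h3]
    rfl
  have hee : e - e' ≠ 0 := by
    intro h
    have h3 : X.1.trace ^ 2 = 4 := by
      rw [htr]
      linear_combination 4 * hf + (e - e') * h
    have h4 := orderOf_dvd_of_pow_eq_one (toPSL_pow_prime_of_trace_sq h3)
    have h5 := Nat.dvd_gcd h4 hd
    have h6 : Nat.gcd p (p - 1) = 1 := by
      exact (Nat.coprime_self_sub_right hp1.le).2 (Nat.coprime_one_right p)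
    rw [h6, Nat.dvd_one] at h5
    omega
  have he0 : e ≠ 0 := by
    rintro rfl
    simp at hf
  obtain rfl : e' = e⁻¹ := by
    field_simp
    linear_combination hf
  have hu : 1 * 1 - f / (e⁻¹ - e) * 0 = 1 := by ring
  refine ⟨g * mkSL2 1 (f / (e⁻¹ - e)) 0 1 hu, e, by simp [he0], ?_⟩
  have h3 : (g * mkSL2 1 (f / (e⁻¹ - e)) 0 1 hu)⁻¹ * X * (g * mkSL2 1 (f / (e⁻¹ - e)) 0 1 hu) =
      (mkSL2 1 (f / (e⁻¹ - e)) 0 1 hu)⁻¹ * (g⁻¹ * X * g) * mkSL2 1 (f / (e⁻¹ - e)) 0 1 hu := by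
    group
  rw [h3, hg, mkSL2_inv, mkSL2_mul, mkSL2_mul, mkSL2_inj]
  have h4 : e⁻¹ - e ≠ 0 := by
    rw [← neg_sub]
    exact neg_ne_zero.2 hee
  refine ⟨by ring, ?_, by ring, by ring⟩
  have h5 : f / (e⁻¹ - e) * (e⁻¹ - e) = f := div_mul_cancel₀ f h4
  linear_combination -h5

end Count

section Involutions

open Matrix

/-- The element of `PSL₂(F)` with the given entries, or `1` if they have the wrong determinant. -/
noncomputable def pslOf {F : Type*} [Field F] (a b c d : F) : PSL(2, F) :=
  open Classical in if h : a * d - b * c = 1 then toPSL F (mkSL2 a b c d h) else 1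

theorem toPSL_mkSL2 {F : Type*} [Field F] {a b c d : F} (h : a * d - b * c = 1) :
    toPSL F (mkSL2 a b c d h) = pslOf a b c d := by
  rw [pslOf, dif_pos h]

theorem pslOf_neg {F : Type*} [Field F] (a b c d : F) :
    pslOf (-a) (-b) (-c) (-d) = pslOf a b c d := by
  by_cases h : a * d - b * c = 1
  · rw [← toPSL_mkSL2 h, ← toPSL_neg, mkSL2_neg, toPSL_mkSL2]
  · rw [pslOf, pslOf, dif_neg h, dif_neg (by simpa using h)]

theorem exists_sq_eq_imp {F : Type*} [Field F] (c : F) :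
    ∃ r₀ : F, ∀ r, r ^ 2 = c → r = r₀ ∨ r = -r₀ := by
  by_cases h : ∃ r : F, r ^ 2 = c
  · obtain ⟨r₀, h⟩ := h
    exact ⟨r₀, fun r hr => sq_eq_sq_iff_eq_or_eq_neg.1 (hr.trans h.symm)⟩
  · exact ⟨0, fun r hr => absurd ⟨r, hr⟩ h⟩

theorem Set.ncard_range_le {α β : Type*} [Finite α] (f : α → β) :
    (Set.range f).ncard ≤ Nat.card α := by
  rw [← Set.image_univ, ← Set.ncard_univ]
  exact Set.ncard_image_le

variable {p : ℕ} [Fact p.Prime]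

theorem ZMod.exists_natCast_eq_or_eq_neg {s : ZMod p} (hs : s ≠ 0) :
    ∃ n ∈ Finset.Icc 1 (p / 2), (n : ZMod p) = s ∨ (n : ZMod p) = -s := by
  refine ⟨s.valMinAbs.natAbs, Finset.mem_Icc.2 ⟨?_, s.natAbs_valMinAbs_le⟩, ?_⟩
  · rwa [Nat.one_le_iff_ne_zero, Ne, Int.natAbs_eq_zero, ZMod.valMinAbs_eq_zero]
  · rw [ZMod.natCast_natAbs_valMinAbs]
    split_ifs
    · exact .inl rfl
    · exact .inr rfl

theorem ncard_involutions_triangular_le :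
    {y : PSL(2, ZMod p) | ∃ r s t hy, (s = 0 ∨ t = 0) ∧
      y = toPSL _ (mkSL2 r s t (-r) hy)}.ncard ≤ 2 * p := by
  obtain ⟨r₀, h₀⟩ := exists_sq_eq_imp (-1 : ZMod p)
  have hsub : {y : PSL(2, ZMod p) | ∃ r s t hy, (s = 0 ∨ t = 0) ∧
      y = toPSL _ (mkSL2 r s t (-r) hy)} ⊆ Set.range (fun s => pslOf r₀ s 0 (-r₀)) ∪
        Set.range (fun t => pslOf r₀ 0 t (-r₀)) := by
    rintro _ ⟨r, s, t, hy, h, rfl⟩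
    rw [toPSL_mkSL2 hy]
    rcases h with rfl | rfl
    · right
      rcases h₀ r (by linear_combination -hy) with rfl | rfl
      · exact ⟨t, rfl⟩
      · exact ⟨-t, by simpa using (pslOf_neg r₀ 0 (-t) (-r₀)).symm⟩
    · left
      rcases h₀ r (by linear_combination -hy) with rfl | rfl
      · exact ⟨s, rfl⟩
      · exact ⟨-s, by simpa using (pslOf_neg r₀ (-s) 0 (-r₀)).symm⟩
  refine (Set.ncard_le_ncard hsub (Set.toFinite _)).trans ((Set.ncard_union_le _ _).trans ?_)
  rw [two_mul]
  gcongr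
  all_goals exact (Set.ncard_range_le _).trans (Nat.card_zmod p).le

theorem ncard_involutions_antidiagonal_le :
    {y : PSL(2, ZMod p) | ∃ s t hy, y = toPSL _ (mkSL2 0 s t (-0) hy)}.ncard ≤ p / 2 := by
  have hsub : {y : PSL(2, ZMod p) | ∃ s t hy, y = toPSL _ (mkSL2 0 s t (-0) hy)} ⊆
      (fun n : ℕ => pslOf (0 : ZMod p) n (-(n : ZMod p)⁻¹) 0) '' Finset.Icc 1 (p / 2) := by
    rintro _ ⟨s, t, hy, rfl⟩
    have hs : s ≠ 0 := by
      rintro rfl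
      simp at hy
    obtain rfl : t = -s⁻¹ := by
      field_simp
      linear_combination -hy
    rw [toPSL_mkSL2 hy]
    obtain ⟨n, hn, h | h⟩ := ZMod.exists_natCast_eq_or_eq_neg hs
    · exact ⟨n, hn, by simp [h]⟩
    · refine ⟨n, hn, ?_⟩
      have := pslOf_neg 0 s (-s⁻¹) 0
      simpa [h, inv_neg] using this
  refine (Set.ncard_le_ncard hsub (Set.toFinite _)).trans ((Set.ncard_image_le).trans ?_)
  simp

theorem ncard_involutions_sq_eq_le (c : ZMod p) :
    {y : PSL(2, ZMod p) | ∃ r s t hy, s ≠ 0 ∧ r ^ 2 = c ∧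
      y = toPSL _ (mkSL2 r s t (-r) hy)}.ncard ≤ p - 1 := by
  obtain ⟨r₀, h₀⟩ := exists_sq_eq_imp c
  have hsub : {y : PSL(2, ZMod p) | ∃ r s t hy, s ≠ 0 ∧ r ^ 2 = c ∧
      y = toPSL _ (mkSL2 r s t (-r) hy)} ⊆
      Set.range (fun s : (ZMod p)ˣ => pslOf r₀ s (-(r₀ ^ 2 + 1) * (s : ZMod p)⁻¹) (-r₀)) := by
    rintro _ ⟨r, s, t, hy, hs, hr, rfl⟩
    obtain rfl : t = -(r ^ 2 + 1) * s⁻¹ := by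
      field_simp
      linear_combination -hy
    rw [toPSL_mkSL2 hy]
    rcases h₀ r hr with rfl | rfl
    · exact ⟨Units.mk0 s hs, rfl⟩
    · refine ⟨-Units.mk0 s hs, ?_⟩
      have := pslOf_neg (-r₀) s (-(r₀ ^ 2 + 1) * s⁻¹) r₀
      simpa [inv_neg] using this
  refine (Set.ncard_le_ncard hsub (Set.toFinite _)).trans ((Set.ncard_range_le _).trans ?_)
  rw [Nat.card_eq_fintype_card, ZMod.card_units]

theorem orderOf_eq_three_of_closure_ne_top (hp : 7 ≤ p)
    (hA4 : HasMaximalSubgroupIsoTo PSL(2, ZMod p) (alternatingGroup (Fin 4)))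
    {a r s t : ZMod p} {ha : a * a⁻¹ - 0 * 0 = 1} {hy : r * -r - s * t = 1} (hr : r ≠ 0)
    (hs : s ≠ 0) (ht : t ≠ 0) (hx : 2 < orderOf (toPSL _ (mkSL2 a 0 0 a⁻¹ ha)))
    (hcl : Subgroup.closure {toPSL _ (mkSL2 a 0 0 a⁻¹ ha), toPSL _ (mkSL2 r s t (-r) hy)} ≠ ⊤) :
    orderOf (toPSL _ (mkSL2 a 0 0 a⁻¹ ha)) = 3 ∧ r ^ 2 = ((a - a⁻¹) ^ 2)⁻¹ := by
  have key : ∀ X : SL(2, ZMod p), 2 < orderOf (toPSL _ X) → toPSL _ X ∈ Subgroup.closure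
      {toPSL _ (mkSL2 a 0 0 a⁻¹ ha), toPSL _ (mkSL2 r s t (-r) hy)} → orderOf (toPSL _ X) = 3 := by
    intro X hX hmem
    have h5 := (orderOf_le_five_of_closure_ne_top (by omega) hr hs ht hx hcl hmem).1
    have h4 : orderOf (toPSL _ X) ≠ 4 := fun h =>
      sq_ne_two_of_maximal_alternatingFour hp hA4 _ (trace_of_orderOf_eq_four h)
    have h5' : orderOf (toPSL _ X) ≠ 5 := fun h => by
      obtain ⟨τ, hτ⟩ := exists_sq_eq_add_one_of_orderOf_eq_five h
      exact sq_ne_add_one_of_maximal_alternatingFour hp hA4 τ hτ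
    omega
  have hxm : toPSL _ (mkSL2 a 0 0 a⁻¹ ha) ∈ Subgroup.closure
      {toPSL _ (mkSL2 a 0 0 a⁻¹ ha), toPSL _ (mkSL2 r s t (-r) hy)} :=
    Subgroup.subset_closure (by simp)
  have hym : toPSL _ (mkSL2 r s t (-r) hy) ∈ Subgroup.closure
      {toPSL _ (mkSL2 a 0 0 a⁻¹ ha), toPSL _ (mkSL2 r s t (-r) hy)} :=
    Subgroup.subset_closure (by simp)
  have haa : a - a⁻¹ ≠ 0 := by
    intro h
    have h1 : toPSL _ (mkSL2 a 0 0 a⁻¹ ha) = 1 := by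
      refine toPSL_eq_one_of_coe_eq_smul (c := a) ?_
      rw [coe_mkSL2, ← sub_eq_zero.1 h]
      ext i j
      fin_cases i <;> fin_cases j <;> simp
    rw [h1, orderOf_one] at hx
    omega
  have htr : (mkSL2 a 0 0 a⁻¹ ha * mkSL2 r s t (-r) hy).1.trace = r * (a - a⁻¹) := by
    rw [mkSL2_mul, trace_mkSL2]
    ring
  refine ⟨key _ hx hxm, ?_⟩
  have h3 := trace_of_orderOf_eq_three (key (mkSL2 a 0 0 a⁻¹ ha * mkSL2 r s t (-r) hy) ?_
    (by rw [map_mul]; exact mul_mem hxm hym))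
  · rw [htr, mul_pow] at h3
    exact eq_inv_of_mul_eq_one_left h3
  · by_contra hle
    have hpos := orderOf_pos (toPSL _ (mkSL2 a 0 0 a⁻¹ ha * mkSL2 r s t (-r) hy))
    have h12 : toPSL _ (mkSL2 a 0 0 a⁻¹ ha * mkSL2 r s t (-r) hy) = 1 ∨
        orderOf (toPSL _ (mkSL2 a 0 0 a⁻¹ ha * mkSL2 r s t (-r) hy)) = 2 := by
      rw [← orderOf_eq_one_iff]
      omega
    rcases h12 with h1 | h2
    · rw [map_mul, mul_eq_one_iff_eq_inv] at h1
      rw [h1, orderOf_inv] at hx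
      have h2 : toPSL _ (mkSL2 r s t (-r) hy) ^ 2 = 1 := toPSL_sq_eq_one (by simp)
      have := Nat.le_of_dvd two_pos (orderOf_dvd_of_pow_eq_one h2)
      omega
    · have h0 := trace_of_orderOf_eq_two h2
      rw [htr] at h0
      exact mul_ne_zero hr haa h0

theorem two_mul_ncard_involutions_le (hp : 7 ≤ p)
    (hA4 : HasMaximalSubgroupIsoTo PSL(2, ZMod p) (alternatingGroup (Fin 4)))
    {a : ZMod p} {ha : a * a⁻¹ - 0 * 0 = 1} (hx : 2 < orderOf (toPSL _ (mkSL2 a 0 0 a⁻¹ ha)))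
    (hd : orderOf (toPSL _ (mkSL2 a 0 0 a⁻¹ ha)) ∣ p - 1) :
    2 * orderOf (toPSL _ (mkSL2 a 0 0 a⁻¹ ha)) + 2 * {y : PSL(2, ZMod p) | orderOf y = 2 ∧
      Subgroup.closure {toPSL _ (mkSL2 a 0 0 a⁻¹ ha), y} ≠ ⊤}.ncard ≤ 7 * (p - 1) + 10 := by
  set x := toPSL _ (mkSL2 a 0 0 a⁻¹ ha) with hxdef
  have h1 := ncard_involutions_triangular_le (p := p)
  have h2 := ncard_involutions_antidiagonal_le (p := p)
  have h3 := ncard_involutions_sq_eq_le ((a - a⁻¹) ^ 2)⁻¹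
  set T := {y : PSL(2, ZMod p) | ∃ r s t hy, (s = 0 ∨ t = 0) ∧
      y = toPSL _ (mkSL2 r s t (-r) hy)}
  set U := {y : PSL(2, ZMod p) | ∃ s t hy, y = toPSL _ (mkSL2 0 s t (-0) hy)}
  set V := {y : PSL(2, ZMod p) | ∃ r s t hy, s ≠ 0 ∧ r ^ 2 = ((a - a⁻¹) ^ 2)⁻¹ ∧
      y = toPSL _ (mkSL2 r s t (-r) hy)}
  have key : ∀ y, orderOf y = 2 → Subgroup.closure {x, y} ≠ ⊤ →
      (y ∈ T ∨ y ∈ U) ∨ y ∈ V ∧ orderOf x = 3 := by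
    intro y hy2 hcl
    obtain ⟨Y, rfl⟩ := toPSL_surjective y
    have htr := trace_of_orderOf_eq_two hy2
    obtain ⟨r, s, t, r', hY, rfl⟩ := exists_eq_mkSL2 Y
    rw [trace_mkSL2] at htr
    obtain rfl : r' = -r := by linear_combination htr
    by_cases hst : s = 0 ∨ t = 0
    · exact .inl (.inl ⟨r, s, t, hY, hst, rfl⟩)
    · rw [not_or] at hst
      by_cases hr : r = 0
      · subst hr
        exact .inl (.inr ⟨s, t, hY, rfl⟩)
      · obtain ⟨h5, h6⟩ := orderOf_eq_three_of_closure_ne_top hp hA4 hr hst.1 hst.2 hx hcl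
        exact .inr ⟨⟨r, s, t, hY, hst.1, h6, rfl⟩, h5⟩
  have hle := Nat.le_of_dvd (by omega) hd
  have hodd := (Fact.out : p.Prime).eq_two_or_odd
  by_cases h : orderOf x = 3
  · have h4 := Set.ncard_le_ncard (s := {y | orderOf y = 2 ∧ Subgroup.closure {x, y} ≠ ⊤})
      (t := (T ∪ U) ∪ V) (fun y hy => (key y hy.1 hy.2).imp id And.left) (Set.toFinite _)
    have h5 := Set.ncard_union_le (T ∪ U) V
    have h6 := Set.ncard_union_le T U
    omega
  · have h4 := Set.ncard_le_ncard (s := {y | orderOf y = 2 ∧ Subgroup.closure {x, y} ≠ ⊤})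
      (t := T ∪ U) (fun y hy => (key y hy.1 hy.2).resolve_right fun h' => h h'.2) (Set.toFinite _)
    have h6 := Set.ncard_union_le T U
    omega

end Involutions

theorem coclique_bound_main2a (p : ℕ) (hp : p.Prime) (hp2 : 2 < p)
    (A : Set PSL(2, ZMod p)) (hA : IsMaximalCoclique A)
    (hnotmax : ∀ M : Subgroup PSL(2, ZMod p), IsCoatom M → A ≠ (M : Set PSL(2, ZMod p)))
    (x : PSL(2, ZMod p)) (hxA : x ∈ A) (hx2 : 2 < orderOf x)
    (hinv : ∀ y ∈ A, y ∉ Subgroup.zpowers x → orderOf y = 2)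
    (hxdvd : orderOf x ∣ p - 1)
    (hA4 : HasMaximalSubgroupIsoTo PSL(2, ZMod p) (alternatingGroup (Fin 4))) :
    2 * A.ncard ≤ 7 * (p - 1) + 10 := by
  have h5 : ∀ t : ZMod 5, t ^ 2 ≠ 2 := by decide
  have := Fact.mk hp
  obtain ⟨X, rfl⟩ := toPSL_surjective x
  have hp7 : 7 ≤ p := by
    by_contra hlt
    have hle := Nat.le_of_dvd (by omega) hxdvd
    interval_cases p
    · omega
    · norm_num at hp
    · have h4 : orderOf (toPSL _ X) = 4 := by
        have h3 : orderOf (toPSL _ X) ≠ 3 := fun h => by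
          rw [h] at hxdvd
          omega
        omega
      have h2 := trace_of_orderOf_eq_four h4
      exact absurd h2 (h5 _)
    · norm_num at hp
  obtain ⟨g, a, ha, hg⟩ := exists_conj_diagonal hx2 hxdvd
  set D := mkSL2 a 0 0 a⁻¹ ha
  have hXD : MulAut.conj (toPSL _ g) (toPSL _ D) = toPSL _ X := by
    rw [MulAut.conj_apply, ← hg, ← map_inv, ← map_mul, ← map_mul]
    congr 1
    group
  have hord : orderOf (toPSL _ D) = orderOf (toPSL _ X) := by
    rw [← hXD]
    exact (MulEquiv.orderOf_eq _ _).symm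
  have hbound := two_mul_ncard_involutions_le (ha := ha) hp7 hA4 (hord ▸ hx2) (hord ▸ hxdvd)
  set S := {y : PSL(2, ZMod p) | orderOf y = 2 ∧ Subgroup.closure {toPSL _ D, y} ≠ ⊤}
  have hsub : A ⊆ Subgroup.zpowers (toPSL _ X) ∪ MulAut.conj (toPSL _ g) '' S := by
    intro y hyA
    by_cases hy : y ∈ Subgroup.zpowers (toPSL _ X)
    · exact .inl hy
    · right
      obtain ⟨z, rfl⟩ := (MulAut.conj (toPSL _ g)).surjective y
      refine ⟨z, ⟨?_, fun htop => hA.1 _ hxA _ hyA ?_⟩, rfl⟩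
      · exact (MulEquiv.orderOf_eq _ z).symm.trans (hinv _ hyA hy)
      · rw [← hXD, ← Set.image_pair, ← MulEquiv.coe_toMonoidHom, ← MonoidHom.map_closure, htop]
        exact Subgroup.map_top_of_surjective _ (MulAut.conj (toPSL _ g)).surjective
  have h1 := Set.ncard_le_ncard hsub (Set.toFinite _)
  have h2 := Set.ncard_union_le (Subgroup.zpowers (toPSL _ X) : Set PSL(2, ZMod p))
    (MulAut.conj (toPSL _ g) '' S)
  have h3 : (Subgroup.zpowers (toPSL _ X) : Set PSL(2, ZMod p)).ncard = orderOf (toPSL _ X) :=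
    Nat.card_zpowers _
  have h4 : (MulAut.conj (toPSL _ g) '' S).ncard ≤ S.ncard := Set.ncard_image_le (Set.toFinite _)
  rw [hord] at hbound
  omega
end

section
/- Let p > 2 be a prime, G = PSL₂(p), and let A ⊆ G be a maximal coclique which is not the underlying set of a maximal subgroup of G. Suppose A contains an element x of order greater than 2 such that every element of A not lying in the cyclic subgroup ⟨x⟩ has order 2. If the order of x divides p − 1 and G contains A₅ or S₄ (or both) as a maximal subgroup, then |A| ≤ (21/2)(p − 1) + 5, i.e. 2·|A| ≤ 21(p − 1) + 10. -/
open scoped MatrixGroups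

namespace Matrix.SpecialLinearGroup

section Field

variable {F : Type*} [Field F]

lemma det_fin_two_eq_one (g : SL(2, F)) : g 0 0 * g 1 1 - g 0 1 * g 1 0 = 1 := by
  rw [← Matrix.det_fin_two, g.det_coe]

lemma mul_apply_fin_two (g h : SL(2, F)) (i j : Fin 2) :
    (g * h) i j = g i 0 * h 0 j + g i 1 * h 1 j := by
  rw [coe_mul, Matrix.mul_apply, Fin.sum_univ_two]

lemma mem_center_iff_fin_two {g : SL(2, F)} :
    g ∈ Subgroup.center SL(2, F) ↔ g 0 1 = 0 ∧ g 1 0 = 0 ∧ g 0 0 = g 1 1 := by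
  rw [mem_center_iff]
  constructor
  · rintro ⟨r, -, hr⟩
    simp [← hr]
  · rintro ⟨h01, h10, h⟩
    have hd := det_fin_two_eq_one g
    refine ⟨g 0 0, ?_, ?_⟩
    · rw [Fintype.card_fin]
      linear_combination hd + g 0 1 * h10 + g 0 0 * h
    · ext i j
      fin_cases i <;> fin_cases j <;> simp [h01, h10, h]

/-- Powers of `g` are affine functions of `g`. -/
lemma coe_pow_succ_of_coe_pow {g : SL(2, F)} {n : ℕ} {α β : F}
    (h : ((g ^ n : SL(2, F)) : Matrix (Fin 2) (Fin 2) F) = α • (g : Matrix _ _ F) - β • 1) :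
    ((g ^ (n + 1) : SL(2, F)) : Matrix (Fin 2) (Fin 2) F) =
      (α * (g 0 0 + g 1 1) - β) • (g : Matrix _ _ F) - α • 1 := by
  have hd := det_fin_two_eq_one g
  rw [pow_succ, coe_mul, h]
  ext i j
  fin_cases i <;> fin_cases j <;> simp [Matrix.mul_apply, Fin.sum_univ_two]
  · linear_combination (-α) * hd
  · ring
  · ring
  · linear_combination (-α) * hd

lemma eq_zero_of_pow_mem_center {g : SL(2, F)} (hg : g ∉ Subgroup.center SL(2, F)) {n : ℕ}
    {α β : F} (h : ((g ^ n : SL(2, F)) : Matrix (Fin 2) (Fin 2) F) = α • (g : Matrix _ _ F) - β • 1)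
    (hn : g ^ n ∈ Subgroup.center SL(2, F)) : α = 0 := by
  rw [mem_center_iff_fin_two] at hn hg
  by_contra hα
  refine hg ?_
  simp only [h] at hn
  simp [hα] at hn
  exact hn

/-- A noncentral element whose projective order is at most five has trace a root of an explicit
polynomial. -/
lemma trace_of_pow_mem_center {g : SL(2, F)} (hg : g ∉ Subgroup.center SL(2, F)) {n : ℕ}
    (hn0 : 0 < n) (hn5 : n ≤ 5) (hn : g ^ n ∈ Subgroup.center SL(2, F)) {t : F}
    (ht : t = g 0 0 + g 1 1) :
    t * (t ^ 2 - 1) * (t ^ 2 - 2) * (t ^ 4 - 3 * t ^ 2 + 1) = 0 := by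
  have h1 : ((g ^ 1 : SL(2, F)) : Matrix (Fin 2) (Fin 2) F) =
      (1 : F) • (g : Matrix _ _ F) - (0 : F) • 1 := by simp
  have h2 := coe_pow_succ_of_coe_pow h1
  have h3 := coe_pow_succ_of_coe_pow h2
  have h4 := coe_pow_succ_of_coe_pow h3
  have h5 := coe_pow_succ_of_coe_pow h4
  rw [← ht] at h2 h3 h4 h5
  interval_cases n
  · rw [pow_one] at hn
    exact (hg hn).elim
  · have := eq_zero_of_pow_mem_center hg h2 hn
    linear_combination (t ^ 2 - 1) * (t ^ 2 - 2) * (t ^ 4 - 3 * t ^ 2 + 1) * this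
  · have := eq_zero_of_pow_mem_center hg h3 hn
    linear_combination t * (t ^ 2 - 2) * (t ^ 4 - 3 * t ^ 2 + 1) * this
  · have := eq_zero_of_pow_mem_center hg h4 hn
    linear_combination (t ^ 2 - 1) * (t ^ 4 - 3 * t ^ 2 + 1) * this
  · have := eq_zero_of_pow_mem_center hg h5 hn
    linear_combination t * (t ^ 2 - 1) * (t ^ 2 - 2) * this

lemma trace_eq_zero_of_sq_mem_center {g : SL(2, F)} (hg : g ∉ Subgroup.center SL(2, F))
    (h : g ^ 2 ∈ Subgroup.center SL(2, F)) : g 0 0 + g 1 1 = 0 := by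
  have h1 : ((g ^ 1 : SL(2, F)) : Matrix (Fin 2) (Fin 2) F) =
      (1 : F) • (g : Matrix _ _ F) - (0 : F) • 1 := by simp
  simpa using eq_zero_of_pow_mem_center hg (coe_pow_succ_of_coe_pow h1) h

lemma exists_conj_of_eigenvalue (g : SL(2, F)) {l : F} (hl : l ^ 2 - (g 0 0 + g 1 1) * l + 1 = 0) :
    ∃ P : SL(2, F), (P⁻¹ * g * P) 1 0 = 0 ∧ (P⁻¹ * g * P) 0 0 = l := by
  have hd := det_fin_two_eq_one g
  obtain ⟨v, hv, hgv⟩ : ∃ v : Fin 2 → F, v ≠ 0 ∧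
      ((g : Matrix (Fin 2) (Fin 2) F) - l • 1) *ᵥ v = 0 := by
    rw [Matrix.exists_mulVec_eq_zero_iff, Matrix.det_fin_two]
    simp
    linear_combination hl + hd
  have h0 := congrFun hgv 0
  have h1 := congrFun hgv 1
  simp [Matrix.mulVec, dotProduct, Fin.sum_univ_two] at h0 h1
  have hcop : IsCoprime (v 0) (v 1) := by
    by_cases hv0 : v 0 = 0
    · have hv1 : v 1 ≠ 0 := fun h => hv (by ext i; fin_cases i <;> simp [hv0, h])
      exact ⟨0, (v 1)⁻¹, by simp [hv1]⟩
    · exact ⟨(v 0)⁻¹, 0, by simp [hv0]⟩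
  obtain ⟨P, hP0, hP1⟩ := hcop.exists_SL2_col 0
  have hP := det_fin_two_eq_one P
  refine ⟨P, ?_, ?_⟩ <;>
    simp [mul_apply_fin_two, Matrix.adjugate_fin_two]
  · rw [hP0, hP1]
    linear_combination v 0 * h1 - v 1 * h0
  · rw [hP0, hP1] at hP ⊢
    linear_combination P 1 1 * h0 - P 0 1 * h1 + l * hP

/-- The upper unitriangular matrix with off-diagonal entry `s`. -/
def upper (s : F) : SL(2, F) := ⟨!![1, s; 0, 1], by simp [Matrix.det_fin_two]⟩

@[simp] lemma coe_upper (s : F) : (upper s : Matrix (Fin 2) (Fin 2) F) = !![1, s; 0, 1] := rfl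

/-- The lower unitriangular matrix with off-diagonal entry `s`. -/
def lower (s : F) : SL(2, F) := ⟨!![1, 0; s, 1], by simp [Matrix.det_fin_two]⟩

@[simp] lemma coe_lower (s : F) : (lower s : Matrix (Fin 2) (Fin 2) F) = !![1, 0; s, 1] := rfl

lemma exists_conj_diagonal (g : SL(2, F)) {d : F} (hd : (g 0 0 + g 1 1) ^ 2 - 4 = d ^ 2)
    (hd0 : d ≠ 0) (h2 : (2 : F) ≠ 0) :
    ∃ P : SL(2, F), (P⁻¹ * g * P) 0 1 = 0 ∧ (P⁻¹ * g * P) 1 0 = 0 ∧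
      (P⁻¹ * g * P) 0 0 ≠ (P⁻¹ * g * P) 1 1 := by
  obtain ⟨P, h10, h00⟩ := exists_conj_of_eigenvalue g (l := (g 0 0 + g 1 1 + d) / 2) (by
    field_simp
    linear_combination -hd)
  set k := P⁻¹ * g * P with hk
  have htr : k 0 0 + k 1 1 = g 0 0 + g 1 1 := by
    have : (k : Matrix (Fin 2) (Fin 2) F).trace = (g : Matrix (Fin 2) (Fin 2) F).trace := by
      rw [hk, mul_assoc, coe_mul, Matrix.trace_mul_comm, ← coe_mul, mul_assoc, mul_inv_cancel,
        mul_one]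
    simpa [Matrix.trace_fin_two] using this
  have hne : k 0 0 - k 1 1 = d := by
    field_simp at h00
    linear_combination h00 - htr
  have hne' : k 0 0 - k 1 1 ≠ 0 := hne ▸ hd0
  refine ⟨P * upper (-(k 0 1 / (k 0 0 - k 1 1))), ?_⟩
  have : (P * upper (-(k 0 1 / (k 0 0 - k 1 1))))⁻¹ * g * (P * upper (-(k 0 1 / (k 0 0 - k 1 1)))) =
      (upper (-(k 0 1 / (k 0 0 - k 1 1))))⁻¹ * k * upper (-(k 0 1 / (k 0 0 - k 1 1))) := by
    rw [hk]; group
  rw [this]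
  simp [mul_apply_fin_two, Matrix.adjugate_fin_two, h10]
  refine ⟨?_, sub_ne_zero.mp hne'⟩
  field_simp
  ring

/-- A subgroup containing all upper unitriangular matrices and an element that is not upper
triangular is everything. -/
lemma eq_top_of_upper_mem {H : Subgroup SL(2, F)} (hU : ∀ s, upper s ∈ H) {h : SL(2, F)}
    (hh : h ∈ H) (hh0 : h 1 0 ≠ 0) : H = ⊤ := by
  have bruhat (k : SL(2, F)) (hk : k 1 0 = h 1 0) : k ∈ H := by
    have : k = upper ((k 0 0 - h 0 0) / h 1 0) * h * upper ((k 1 1 - h 1 1) / h 1 0) := by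
      have dk := det_fin_two_eq_one k
      have dh := det_fin_two_eq_one h
      rw [hk] at dk
      ext i j
      fin_cases i <;> fin_cases j <;> simp [mul_apply_fin_two, hk] <;>
        field_simp
      · ring
      · linear_combination -dk + dh
      · ring
    rw [this]
    exact H.mul_mem (H.mul_mem (hU _) hh) (hU _)
  have hL (c : F) : lower c ∈ H := by
    obtain ⟨w, hwe⟩ : ∃ w : SL(2, F),
        (w : Matrix (Fin 2) (Fin 2) F) = !![0, -(h 1 0)⁻¹; h 1 0, 0] :=
      ⟨⟨_, by simp [Matrix.det_fin_two, hh0]⟩, rfl⟩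
    have hw : w ∈ H := bruhat w (by simp [hwe])
    have : lower c = w * upper (-c / (h 1 0) ^ 2) * w⁻¹ := by
      ext i j
      fin_cases i <;> fin_cases j <;>
        simp [hwe, mul_apply_fin_two, Matrix.adjugate_fin_two, hh0]
      field_simp
    rw [this]
    exact H.mul_mem (H.mul_mem hw (hU _)) (H.inv_mem hw)
  have nonzero (k : SL(2, F)) (hk : k 1 0 ≠ 0) : k ∈ H := by
    have : k = upper ((k 0 0 - 1) / k 1 0) * lower (k 1 0) *
        upper ((k 1 1 - 1) / k 1 0) := by
      have dk := det_fin_two_eq_one k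
      ext i j
      fin_cases i <;> fin_cases j <;> simp [mul_apply_fin_two] <;>
        field_simp
      · ring
      · linear_combination -dk
      · ring
    rw [this]
    exact H.mul_mem (H.mul_mem (hU _) (hL _)) (hU _)
  refine eq_top_iff.mpr fun k _ => ?_
  by_cases hk : k 1 0 = 0
  · have h2 := nonzero (k * h) (by
      have dk := det_fin_two_eq_one k
      have : k 1 1 ≠ 0 := by
        intro h; rw [h, hk] at dk; simp at dk
      simp [mul_apply_fin_two, hk, this, hh0])
    simpa using H.mul_mem h2 (H.inv_mem hh)
  · exact nonzero k hk

end Field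

section PrimeField

variable {p : ℕ} [Fact p.Prime]

/-- The `p`-th power of `g` in terms of the discriminant of its characteristic polynomial. -/
lemma two_smul_pow_card (hp2 : 2 < p) (g : SL(2, ZMod p)) :
    (2 : ZMod p) • ((g ^ p : SL(2, ZMod p)) : Matrix (Fin 2) (Fin 2) (ZMod p)) =
      (g 0 0 + g 1 1) • 1 + (((g 0 0 + g 1 1) ^ 2 - 4) ^ (p / 2)) •
        ((2 : ZMod p) • (g : Matrix (Fin 2) (Fin 2) (ZMod p)) - (g 0 0 + g 1 1) • 1) := by
  have hd := det_fin_two_eq_one g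
  set t := g 0 0 + g 1 1 with ht
  set M := (g : Matrix (Fin 2) (Fin 2) (ZMod p)) with hM
  have hsq : ((2 : ZMod p) • M - t • 1) ^ 2 = (t ^ 2 - 4) • 1 := by
    rw [pow_two]
    ext i j
    fin_cases i <;> fin_cases j <;> simp [Matrix.mul_apply, Fin.sum_univ_two, ht]
    · linear_combination -4 * hd
    · ring
    · ring
    · linear_combination -4 * hd
  have hodd : p = 2 * (p / 2) + 1 := by
    have := (Fact.out : p.Prime).eq_two_or_odd
    omega
  have h1 : ((2 : ZMod p) • M - t • 1) ^ p = (2 : ZMod p) • M ^ p - t • 1 := by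
    rw [sub_pow_char_of_commute (p := p), smul_pow, smul_pow, ZMod.pow_card, ZMod.pow_card, one_pow]
    exact (Commute.one_right _).smul_right t
  have h2 : ((2 : ZMod p) • M - t • 1) ^ p = ((t ^ 2 - 4) ^ (p / 2)) • ((2 : ZMod p) • M - t • 1) := by
    have hm' : ((2 : ZMod p) • M - t • 1) ^ p = ((2 : ZMod p) • M - t • 1) ^ (2 * (p / 2) + 1) :=
      congrArg _ hodd
    rw [hm', pow_succ, pow_mul, hsq, smul_pow, one_pow, smul_mul_assoc, one_mul]
  rw [coe_pow, ← hM, ← h2, h1]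
  abel

lemma two_ne_zero_of_two_lt (hp2 : 2 < p) : (2 : ZMod p) ≠ 0 :=
  Ring.two_ne_zero (by rw [ZMod.ringChar_zmod_n]; omega)

lemma pow_card_mem_center (hp2 : 2 < p) {g : SL(2, ZMod p)} (hg : (g 0 0 + g 1 1) ^ 2 - 4 = 0) :
    g ^ p ∈ Subgroup.center SL(2, ZMod p) := by
  have h := two_smul_pow_card hp2 g
  have h2 := two_ne_zero_of_two_lt hp2
  have hp : p / 2 ≠ 0 := by omega
  rw [hg, zero_pow hp, zero_smul, add_zero] at h
  have e (i j) := congrFun (congrFun h i) j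
  have e01 := e 0 1
  have e10 := e 1 0
  have e00 := e 0 0
  have e11 := e 1 1
  simp [h2] at e01 e10 e00 e11
  rw [mem_center_iff_fin_two]
  exact ⟨e01, e10, mul_left_cancel₀ h2 (by rw [coe_pow, e00, e11])⟩

lemma pow_card_succ_eq_one (hp2 : 2 < p) {g : SL(2, ZMod p)}
    (hg : ¬ IsSquare ((g 0 0 + g 1 1) ^ 2 - 4)) : g ^ (p + 1) = 1 := by
  have h := two_smul_pow_card hp2 g
  have h2 := two_ne_zero_of_two_lt hp2
  have h0 : (g 0 0 + g 1 1) ^ 2 - 4 ≠ 0 := fun h0 => hg (by rw [h0]; exact IsSquare.zero)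
  rw [((ZMod.pow_div_two_eq_neg_one_or_one p h0).resolve_left
    fun h1 => hg ((ZMod.euler_criterion p h0).mpr h1))] at h
  have : g ^ p = g⁻¹ := by
    have e (i j) := congrFun (congrFun h i) j
    ext i j
    refine mul_left_cancel₀ h2 ?_
    have := e i j
    simp only [Matrix.smul_apply, smul_eq_mul] at this
    rw [this]
    fin_cases i <;> fin_cases j <;> simp [Matrix.adjugate_fin_two] <;> ring
  rw [pow_succ, this, inv_mul_cancel]

/-- An element with vanishing discriminant and order prime to `p` is central. -/
lemma discr_ne_zero_of_coprime (hp2 : 2 < p) {g : SL(2, ZMod p)}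
    (hg : g ∉ Subgroup.center SL(2, ZMod p)) {n : ℕ} (hn : n.Coprime p) (hgn : g ^ n = 1) :
    (g 0 0 + g 1 1) ^ 2 - 4 ≠ 0 := by
  intro h
  have h1 := pow_card_mem_center hp2 h
  refine hg ?_
  rw [← QuotientGroup.eq_one_iff] at h1 ⊢
  rw [← orderOf_eq_one_iff, ← Nat.dvd_one, ← hn]
  refine Nat.dvd_gcd ?_ (orderOf_dvd_of_pow_eq_one h1)
  exact orderOf_dvd_of_pow_eq_one (by rw [← QuotientGroup.mk_pow, hgn, QuotientGroup.mk_one])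

/-- A subgroup of order divisible by `p` that fixes no common line is everything. -/
lemma eq_top_or_exists_conj (H : Subgroup SL(2, ZMod p)) (hH : p ∣ Nat.card H) :
    H = ⊤ ∨ ∃ P : SL(2, ZMod p), ∀ h ∈ H, (P⁻¹ * h * P) 1 0 = 0 := by
  obtain ⟨⟨u, huH⟩, hu⟩ := exists_prime_orderOf_dvd_card' p hH
  rw [Subgroup.orderOf_mk] at hu
  have hup : u ^ p = 1 := orderOf_dvd_iff_pow_eq_one.mp hu.dvd
  have hu1 : u ≠ 1 := fun h => by
    rw [h, orderOf_one] at hu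
    exact (Fact.out : p.Prime).one_lt.ne hu
  have hdet : Matrix.det ((u : Matrix (Fin 2) (Fin 2) (ZMod p)) - 1) = 0 := by
    have : ((u : Matrix (Fin 2) (Fin 2) (ZMod p)) - 1) ^ p = 0 := by
      rw [sub_pow_char_of_commute (p := p) (Commute.one_right _), one_pow, ← coe_pow, hup,
        coe_one, sub_self]
    have := congrArg Matrix.det this
    rw [Matrix.det_pow, Matrix.det_zero] at this
    exact pow_eq_zero_iff (Fact.out : p.Prime).ne_zero |>.mp this
  have hd := det_fin_two_eq_one u
  obtain ⟨P, h10, h00⟩ := exists_conj_of_eigenvalue u (l := 1) (by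
    rw [Matrix.det_fin_two] at hdet
    simp at hdet
    linear_combination hdet - hd)
  refine or_iff_not_imp_right.mpr fun hne => ?_
  push Not at hne
  obtain ⟨h, hh, hh0⟩ := hne P
  set K := H.comap (MulAut.conj P).toMonoidHom with hK
  have hmem (k : SL(2, ZMod p)) : k ∈ K ↔ P * k * P⁻¹ ∈ H := by
    simp [hK, Subgroup.mem_comap]
  have hconj (k : SL(2, ZMod p)) (hk : k ∈ H) : P⁻¹ * k * P ∈ K := by
    rw [hmem]
    simpa [mul_assoc] using hk
  set v := P⁻¹ * u * P with hv
  have hv11 : v 1 1 = 1 := by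
    have := det_fin_two_eq_one v
    rw [h10, h00] at this
    simpa using this
  have hv0 : v 0 1 ≠ 0 := by
    intro h01
    have : v = 1 := by
      ext i j
      fin_cases i <;> fin_cases j <;> simp [h10, h00, h01, hv11]
    refine hu1 ?_
    rw [hv] at this
    have h' : u = P * (P⁻¹ * u * P) * P⁻¹ := by group
    rw [h', this]
    simp
  have hvpow (n : ℕ) : v ^ n = upper (n * v 0 1) := by
    induction n with
    | zero => ext i j; fin_cases i <;> fin_cases j <;> simp
    | succ n ih =>
      rw [pow_succ, ih]
      ext i j
      fin_cases i <;> fin_cases j <;> simp [mul_apply_fin_two, h10, h00, hv11]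
      ring
  have hU (s : ZMod p) : upper s ∈ K := by
    have : upper s = v ^ (s / v 0 1).val := by
      rw [hvpow, ZMod.natCast_zmod_val, div_mul_cancel₀ _ hv0]
    rw [this]
    exact K.pow_mem (hconj u huH) _
  have hKtop := eq_top_of_upper_mem hU (hconj h hh) hh0
  refine eq_top_iff.mpr fun k _ => ?_
  have : P⁻¹ * k * P ∈ K := hKtop ▸ Subgroup.mem_top _
  rw [hmem] at this
  simpa [mul_assoc] using this

end PrimeField

end Matrix.SpecialLinearGroup

section PoleCounting

open MulAction

/-- Counting fixed points: a finite group acting on a finite set so that nontrivial elements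
have exactly two fixed points and every point is fixed by some nontrivial element. -/
lemma orbit_of_five_lt_card_stabilizer {G X : Type*} [Group G] [Finite G] [MulAction G X]
    [Finite X] (h2 : ∀ g : G, g ≠ 1 → Nat.card (fixedBy X g) = 2)
    (hP : ∀ x : X, ∃ g : G, g ≠ 1 ∧ g • x = x) (x : X) (hx : 5 < Nat.card (stabilizer G x)) :
    Nat.card (orbit G x) = 1 ∨
      Nat.card (orbit G x) = 2 ∧ ∀ z ∉ orbit G x, Nat.card (stabilizer G z) = 2 := by
  classical
  have := Fintype.ofFinite G
  have := Fintype.ofFinite X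
  have hmul (z : X) : Nat.card (orbit G z) * Nat.card (stabilizer G z) = Nat.card G := by
    have := card_orbit_mul_card_stabilizer_eq_card_group G z
    simpa only [Nat.card_eq_fintype_card] using this
  have hstab (z : X) : 2 ≤ Nat.card (stabilizer G z) := by
    obtain ⟨g, hg, hgz⟩ := hP z
    have : Nontrivial (stabilizer G z) :=
      ⟨⟨g, hgz⟩, 1, fun h => hg (congrArg Subtype.val h)⟩
    exact Finite.one_lt_card
  set N := Nat.card G with hN
  let s : orbitRel.Quotient G X → ℕ := fun ω => Nat.card ω.orbit
  have hs (z : X) : s (Quotient.mk'' z) = Nat.card (orbit G z) := by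
    simp only [s, orbitRel.Quotient.orbit_mk]
  have hpos (ω) : 0 < s ω := by
    induction ω using Quotient.inductionOn' with | h z =>
    rw [hs]
    have : Nonempty (orbit G z) := ⟨⟨z, mem_orbit_self z⟩⟩
    exact Nat.card_pos
  have hhalf (ω) : 2 * s ω ≤ N := by
    induction ω using Quotient.inductionOn' with | h z =>
    rw [hs, ← hmul z, mul_comm]
    exact Nat.mul_le_mul_left _ (hstab z)
  have hsum : ∑ ω, s ω = Nat.card X := by
    rw [Nat.card_congr (selfEquivSigmaOrbits' G X), Nat.card_sigma]
  have hburn : Nat.card X + 2 * N = Fintype.card (orbitRel.Quotient G X) * N + 2 := by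
    have h := sum_card_fixedBy_eq_card_orbits_mul_card_group G X
    rw [← Finset.add_sum_erase _ _ (Finset.mem_univ 1),
      Finset.sum_congr rfl (g := fun _ => 2)] at h
    · have h1 : Fintype.card (fixedBy X (1 : G)) = Nat.card X := by
        rw [← Nat.card_eq_fintype_card, fixedBy_one_eq_univ, Nat.card_univ]
      have hp : 0 < Fintype.card G := Fintype.card_pos
      rw [h1, Finset.sum_const, Finset.card_erase_of_mem (Finset.mem_univ _), Finset.card_univ,
        smul_eq_mul] at h
      rw [hN, Nat.card_eq_fintype_card (α := G)]
      rw [← h]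
      omega
    · intro g hg
      rw [← Nat.card_eq_fintype_card, h2 g (Finset.ne_of_mem_erase hg)]
  set ω₀ : orbitRel.Quotient G X := Quotient.mk'' x with hω₀
  have h0 : s ω₀ * Nat.card (stabilizer G x) = N := by rw [hs, hmul]
  have h06 : 6 * s ω₀ ≤ N := by rw [← h0, mul_comm]; exact Nat.mul_le_mul_left _ hx
  have h0pos := hpos ω₀
  have hcard : Fintype.card (orbitRel.Quotient G X) ≤ 3 := by
    have : ∑ ω, 2 * s ω ≤ ∑ ω : orbitRel.Quotient G X, N := Finset.sum_le_sum fun ω _ => hhalf ω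
    rw [← Finset.mul_sum, hsum, Finset.sum_const, Finset.card_univ, smul_eq_mul] at this
    by_contra! h
    have := Nat.mul_le_mul_right N h
    omega
  have herase := Finset.card_erase_of_mem (Finset.mem_univ ω₀)
  rw [← Finset.add_sum_erase _ _ (Finset.mem_univ ω₀)] at hsum
  rw [Finset.card_univ] at herase
  rw [← hs, ← hω₀]
  have hcpos : 0 < Fintype.card (orbitRel.Quotient G X) := Fintype.card_pos_iff.mpr ⟨ω₀⟩
  obtain hc | hc | hc : Fintype.card (orbitRel.Quotient G X) = 1 ∨
    Fintype.card (orbitRel.Quotient G X) = 2 ∨ Fintype.card (orbitRel.Quotient G X) = 3 := by omega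
  · rw [hc] at hburn herase
    rw [Finset.card_eq_zero.mp herase, Finset.sum_empty] at hsum
    omega
  · rw [hc] at hburn herase
    obtain ⟨ω₁, h₁⟩ := Finset.card_eq_one.mp herase
    rw [h₁, Finset.sum_singleton] at hsum
    have := hpos ω₁
    omega
  · rw [hc] at hburn herase
    obtain ⟨ω₁, ω₂, hne, h₁₂⟩ := Finset.card_eq_two.mp herase
    rw [h₁₂, Finset.sum_pair hne] at hsum
    have key (z : X) (hz : 2 * s (Quotient.mk'' z) = N) : Nat.card (stabilizer G z) = 2 := by
      have h1 := hmul z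
      rw [← hs, ← hz, mul_comm 2] at h1
      exact Nat.eq_of_mul_eq_mul_left (hpos _) h1
    have key' (ω) : 2 * s ω = N ∨ 3 * s ω ≤ N := by
      induction ω using Quotient.inductionOn' with | h z =>
      have h1 := hmul z
      rw [← hs] at h1
      rcases (hstab z).eq_or_lt with h | h
      · left; rw [← h1, ← h, mul_comm]
      · right; rw [← h1, mul_comm]; exact Nat.mul_le_mul_left _ h
    have k1 := key' ω₁
    have k2 := key' ω₂
    have b1 := hhalf ω₁
    have b2 := hhalf ω₂
    have hboth : 2 * s ω₁ = N ∧ 2 * s ω₂ = N := by omega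
    refine Or.inr ⟨by omega, fun z hz => key z ?_⟩
    have hmem : (Quotient.mk'' z : orbitRel.Quotient G X) ∈ Finset.univ.erase ω₀ := by
      refine Finset.mem_erase.mpr ⟨fun h => hz ?_, Finset.mem_univ _⟩
      exact (orbitRel_apply).mp (Quotient.eq''.mp h)
    rw [h₁₂, Finset.mem_insert, Finset.mem_singleton] at hmem
    rcases hmem with h | h <;> rw [h]
    exacts [hboth.1, hboth.2]

/-- If every nontrivial element of a finite group has exactly two fixed points, then either all
elements have order at most five, or the two fixed points of a given element of order greater
than two are special. -/
lemma orderOf_le_five_or_fixes {G X : Type*} [Group G] [Finite G] [MulAction G X]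
    (h2 : ∀ g : G, g ≠ 1 → (fixedBy X g).ncard = 2) {x y : X} (hxy : x ≠ y) {g : G}
    (hg : g ^ 2 ≠ 1) (hgx : g • x = x) (hgy : g • y = y) :
    (∀ h : G, orderOf h ≤ 5) ∨ (∀ h : G, h • x = x) ∨ (∀ h : G, h • y = y) ∨
      ∀ h : G, h • x = x ∨ h • x = y := by
  classical
  refine or_iff_not_imp_left.mpr fun hne => ?_
  push Not at hne
  obtain ⟨k, hk⟩ := hne
  let P : SubMulAction G X :=
    { carrier := {z | ∃ h : G, h ≠ 1 ∧ h • z = z}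
      smul_mem' := by
        rintro c z ⟨h, hh, hz⟩
        exact ⟨c * h * c⁻¹, by simpa [conj_eq_one_iff] using hh, by simp [mul_smul, hz]⟩ }
  have hPfin : Finite P := by
    have : (⋃ h : {h : G // h ≠ 1}, fixedBy X h.1).Finite :=
      Set.finite_iUnion fun h => Set.finite_of_ncard_ne_zero (by rw [h2 _ h.2]; norm_num)
    refine (this.subset ?_).to_subtype
    rintro z ⟨h, hh, hz⟩
    exact Set.mem_iUnion.mpr ⟨⟨h, hh⟩, hz⟩
  have hfix (h : G) (hh : h ≠ 1) : Nat.card (fixedBy P h) = 2 := by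
    rw [← h2 h hh, ← Nat.card_coe_set_eq]
    refine Nat.card_congr
      ⟨fun z => ⟨z.1.1, congrArg Subtype.val z.2⟩, fun z => ⟨⟨z.1, h, hh, z.2⟩, Subtype.ext z.2⟩,
        fun _ => rfl, fun _ => rfl⟩
  have hpole (z : P) : ∃ h : G, h ≠ 1 ∧ h • z = z := by
    obtain ⟨h, hh, hz⟩ := z.2
    exact ⟨h, hh, Subtype.ext hz⟩
  have hk1 : k ≠ 1 := by rintro rfl; simp at hk
  have hg1 : g ≠ 1 := by rintro rfl; simp at hg
  obtain ⟨z, hz⟩ : (fixedBy P k).Nonempty := by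
    have : Nonempty (fixedBy P k) := (Nat.card_pos_iff.mp (by rw [hfix k hk1]; norm_num)).1
    exact Set.nonempty_coe_sort.mp this
  have hzk : 5 < Nat.card (stabilizer G z) := by
    refine hk.trans_le ?_
    rw [← Nat.card_zpowers]
    exact Subgroup.card_le_of_le (by simpa [Subgroup.zpowers_le] using hz)
  have hfixg (w : X) (hw : g • w = w) : w = x ∨ w = y := by
    have hsub : ({x, y} : Set X) ⊆ fixedBy X g := by
      rintro w (rfl | rfl)
      exacts [hgx, hgy]
    have := Set.eq_of_subset_of_ncard_le hsub (by rw [h2 g hg1, Set.ncard_pair hxy])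
      (Set.finite_of_ncard_ne_zero (by rw [h2 _ hg1]; norm_num))
    have hw' : w ∈ ({x, y} : Set X) := this ▸ hw
    simpa using hw'
  rcases orbit_of_five_lt_card_stabilizer hfix hpole z hzk with h1 | ⟨h2', hrest⟩
  · have hall (h : G) : h • (z : X) = z := by
      have : Subsingleton (orbit G z) := (Nat.card_eq_one_iff_unique.mp h1).1
      have := congrArg Subtype.val (Subsingleton.elim (⟨h • z, mem_orbit z h⟩ : orbit G z)
        ⟨z, mem_orbit_self z⟩)
      exact congrArg Subtype.val this
    rcases hfixg z (hall g) with h | h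
    · exact Or.inl (h ▸ hall)
    · exact Or.inr (Or.inl (h ▸ hall))
  · refine Or.inr (Or.inr fun h => ?_)
    have hmem (w : P) (hw : g • w = w) : w ∈ orbit G z := by
      by_contra hcon
      have := hrest w hcon
      have h3 : (⟨g, hw⟩ : stabilizer G w) ^ 2 = 1 := by
        rw [← this]; exact pow_card_eq_one'
      exact hg (congrArg Subtype.val h3)
    let x' : P := ⟨x, g, hg1, hgx⟩
    let y' : P := ⟨y, g, hg1, hgy⟩
    have hx' := hmem x' (Subtype.ext hgx)
    have hy' := hmem y' (Subtype.ext hgy)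
    have hxy' : x' ≠ y' := fun h => hxy (congrArg Subtype.val h)
    have hsub : ({x', y'} : Set P) ⊆ orbit G z := by
      rintro w (rfl | rfl)
      exacts [hx', hy']
    have heq := Set.eq_of_subset_of_ncard_le hsub
      (by rw [Set.ncard_pair hxy', ← Nat.card_coe_set_eq, h2']) (Set.toFinite _)
    have hhx : h • x' ∈ ({x', y'} : Set P) := by
      rw [heq]
      exact mem_orbit_of_mem_orbit h hx'
    rcases hhx with hh | hh
    · exact Or.inl (congrArg Subtype.val hh)
    · exact Or.inr (congrArg Subtype.val hh)

end PoleCounting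

namespace Matrix.SpecialLinearGroup

section Moebius

open OnePoint

variable {F K : Type*} [Field F] [Field K] [DecidableEq K] [Algebra F K]

variable (F K) in
/-- The action of `SL(2, F)` by Möbius transformations on the projective line over an extension
`K` of `F`. -/
noncomputable def moebius : SL(2, F) →* Equiv.Perm (OnePoint K) :=
  (MulAction.toPermHom (GL (Fin 2) K) (OnePoint K)).comp
    (toGL.comp (SpecialLinearGroup.map (algebraMap F K)))

lemma moebius_infty (g : SL(2, F)) : moebius F K g ∞ =
    if algebraMap F K (g 1 0) = 0 then ∞ else
      ((algebraMap F K (g 0 0) / algebraMap F K (g 1 0) : K) : OnePoint K) := by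
  have := smul_infty_eq_ite (toGL (SpecialLinearGroup.map (algebraMap F K) g))
  exact this

lemma moebius_coe (g : SL(2, F)) (k : K) : moebius F K g k =
    if algebraMap F K (g 1 0) * k + algebraMap F K (g 1 1) = 0 then ∞ else
      (((algebraMap F K (g 0 0) * k + algebraMap F K (g 0 1)) /
        (algebraMap F K (g 1 0) * k + algebraMap F K (g 1 1)) : K) : OnePoint K) := by
  have := smul_some_eq_ite (g := toGL (SpecialLinearGroup.map (algebraMap F K) g)) (k := k)
  simpa [moebius] using this

lemma moebius_infty_eq_iff (g : SL(2, F)) : moebius F K g ∞ = ∞ ↔ g 1 0 = 0 := by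
  rw [moebius_infty]
  split_ifs with h <;> simpa using h

lemma moebius_infty_eq_zero_iff (g : SL(2, F)) :
    moebius F K g ∞ = ((0 : K) : OnePoint K) ↔ g 0 0 = 0 := by
  have hd := det_fin_two_eq_one g
  rw [moebius_infty]
  split_ifs with h
  · rw [(map_eq_zero _).mp h, mul_zero, sub_zero] at hd
    simp [left_ne_zero_of_mul_eq_one hd]
  · rw [OnePoint.coe_eq_coe]
    simp [h]

lemma moebius_coe_eq_iff (g : SL(2, F)) (k : K) : moebius F K g k = k ↔
    algebraMap F K (g 1 0) * (k * k) + algebraMap F K (g 1 1 - g 0 0) * k +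
      algebraMap F K (- g 0 1) = 0 := by
  have hd := congrArg (algebraMap F K) (det_fin_two_eq_one g)
  simp only [map_sub, map_mul, map_one] at hd
  rw [moebius_coe]
  simp only [map_sub, map_neg]
  split_ifs with h
  · refine ⟨fun h' => (OnePoint.infty_ne_coe _ h').elim, fun h' => ?_⟩
    exfalso
    refine one_ne_zero (α := K) ?_
    grind
  · rw [OnePoint.coe_eq_coe, div_eq_iff h]
    grind

lemma moebius_zero_eq_iff (g : SL(2, F)) :
    moebius F K g ((0 : K) : OnePoint K) = ((0 : K) : OnePoint K) ↔ g 0 1 = 0 := by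
  rw [moebius_coe_eq_iff]
  simp

lemma moebius_eq_one_iff (g : SL(2, F)) :
    moebius F K g = 1 ↔ g ∈ Subgroup.center SL(2, F) := by
  rw [mem_center_iff_fin_two]
  constructor
  · intro h
    have h10 := (moebius_infty_eq_iff (K := K) g).mp (by rw [h]; rfl)
    have h01 := (moebius_zero_eq_iff (K := K) g).mp (by rw [h]; rfl)
    have h1 := (moebius_coe_eq_iff (K := K) g 1).mp (by rw [h]; rfl)
    simp [h10, h01, sub_eq_zero] at h1
    exact ⟨h01, h10, h1.symm⟩
  · rintro ⟨h01, h10, h⟩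
    ext z
    induction z using OnePoint.rec with
    | infty => exact (moebius_infty_eq_iff g).mpr h10
    | coe k => exact (moebius_coe_eq_iff g k).mpr (by simp [h01, h10, h])

lemma ncard_fixedPoints_moebius [IsAlgClosed K] (h2 : (2 : F) ≠ 0) {g : SL(2, F)}
    (hg : (g 0 0 + g 1 1) ^ 2 - 4 ≠ 0) : {z | moebius F K g z = z}.ncard = 2 := by
  have hd := det_fin_two_eq_one g
  have h2K : (2 : K) ≠ 0 := by
    rw [← map_ofNat (algebraMap F K) 2]
    exact (map_ne_zero _).mpr h2
  have : NeZero (2 : K) := ⟨h2K⟩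
  obtain ⟨e, he⟩ := IsAlgClosed.exists_eq_mul_self (algebraMap F K ((g 0 0 + g 1 1) ^ 2 - 4))
  have he0 : e ≠ 0 := by
    rintro rfl
    rw [mul_zero] at he
    exact hg ((map_eq_zero _).mp he)
  by_cases h10 : g 1 0 = 0
  · have hne : g 1 1 - g 0 0 ≠ 0 := by
      intro h
      refine hg ?_
      rw [h10] at hd
      linear_combination (g 1 1 - g 0 0) * h + 4 * hd
    have hne' := (map_ne_zero (algebraMap F K)).mpr hne
    have : {z | moebius F K g z = z} =
        {∞, ((algebraMap F K (g 0 1) / algebraMap F K (g 1 1 - g 0 0) : K) : OnePoint K)} := by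
      ext z
      induction z using OnePoint.rec with
      | infty => simpa [moebius_infty_eq_iff] using h10
      | coe k =>
        simp only [Set.mem_ofPred_eq, moebius_coe_eq_iff, h10, map_zero,
          Set.mem_insert_iff, OnePoint.coe_ne_infty, Set.mem_singleton_iff, false_or,
          OnePoint.coe_eq_coe, eq_div_iff hne', map_neg, ← sub_eq_add_neg, sub_eq_zero, mul_comm _ k]
        rw [zero_mul, zero_add]
    rw [this, Set.ncard_pair (OnePoint.infty_ne_coe _)]
  · have h10' := (map_ne_zero (algebraMap F K)).mpr h10
    have hdis : discrim (algebraMap F K (g 1 0)) (algebraMap F K (g 1 1 - g 0 0))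
        (algebraMap F K (-g 0 1)) = e * e := by
      rw [← he, discrim]
      have : (g 1 1 - g 0 0) ^ 2 - 4 * g 1 0 * (-g 0 1) = (g 0 0 + g 1 1) ^ 2 - 4 := by
        linear_combination -4 * hd
      rw [← this]
      simp only [map_sub, map_mul, map_pow, map_ofNat]
    set b := algebraMap F K (g 1 1 - g 0 0)
    set c := algebraMap F K (g 1 0)
    have : {z | moebius F K g z = z} =
        {(((-b + e) / (2 * c) : K) : OnePoint K), (((-b - e) / (2 * c) : K) : OnePoint K)} := by
      ext z
      induction z using OnePoint.rec with
      | infty => simpa [moebius_infty_eq_iff] using h10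
      | coe k =>
        simp only [Set.mem_ofPred_eq, moebius_coe_eq_iff, Set.mem_insert_iff, OnePoint.coe_eq_coe,
          Set.mem_singleton_iff]
        exact quadratic_eq_zero_iff h10' hdis k
    rw [this, Set.ncard_pair]
    rw [Ne, OnePoint.coe_eq_coe, div_left_inj' (mul_ne_zero h2K h10')]
    intro h
    exact he0 (mul_left_cancel₀ h2K (by linear_combination h))

end Moebius

section Dichotomy

variable {p : ℕ} [Fact p.Prime]

/-- If a diagonal `g` of projective order greater than two and a trace zero `y` generate a proper
subgroup of `SL(2, p)`, then `y` is triangular or the trace of `g * y` is a root of an explicit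
polynomial. -/
lemma triangular_or_trace_of_closure_ne_top (hp2 : 2 < p) {g y : SL(2, ZMod p)}
    (hg01 : g 0 1 = 0) (hg10 : g 1 0 = 0) (hg : g ^ 2 ∉ Subgroup.center SL(2, ZMod p))
    (hy : y 0 0 + y 1 1 = 0) (hH : Subgroup.closure {g, y} ≠ ⊤) {t : ZMod p}
    (ht : t = (g * y) 0 0 + (g * y) 1 1) :
    y 0 1 = 0 ∨ y 1 0 = 0 ∨ t * (t ^ 2 - 1) * (t ^ 2 - 2) * (t ^ 4 - 3 * t ^ 2 + 1) = 0 := by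
  classical
  set H := Subgroup.closure {g, y}
  have hgH : g ∈ H := Subgroup.subset_closure (by simp)
  have hyH : y ∈ H := Subgroup.subset_closure (by simp)
  have hgne : g 0 0 ≠ g 1 1 := fun h =>
    hg (Subgroup.pow_mem _ (mem_center_iff_fin_two.mpr ⟨hg01, hg10, h⟩) 2)
  have hdiag : (g * y) ∈ Subgroup.center SL(2, ZMod p) → y 1 0 = 0 := by
    intro h
    have hd := det_fin_two_eq_one g
    rw [hg01, zero_mul, sub_zero] at hd
    have := (mem_center_iff_fin_two.mp h).2.1
    rw [mul_apply_fin_two, hg10, zero_mul, zero_add] at this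
    exact (mul_eq_zero.mp this).resolve_left (right_ne_zero_of_mul_eq_one hd)
  by_cases hpH : p ∣ Nat.card H
  · obtain ⟨P, hP⟩ := (eq_top_or_exists_conj H hpH).resolve_left hH
    have h1 := hP g hgH
    have h2 := hP y hyH
    have hdP := det_fin_two_eq_one P
    simp [mul_apply_fin_two, Matrix.adjugate_fin_two, hg01, hg10] at h1 h2
    have h3 : P 0 0 * P 1 0 = 0 := by
      have : (P 0 0 * P 1 0) * (g 1 1 - g 0 0) = 0 := by linear_combination h1
      exact (mul_eq_zero.mp this).resolve_right (sub_ne_zero.mpr hgne.symm)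
    rcases mul_eq_zero.mp h3 with h | h
    · rw [h] at h2 hdP
      have h10 : P 1 0 ≠ 0 := fun h => by rw [h] at hdP; simp at hdP
      simp [h10] at h2
      exact Or.inl h2
    · rw [h] at h2 hdP
      have h00 : P 0 0 ≠ 0 := fun h => by rw [h] at hdP; simp at hdP
      simp [h00] at h2
      exact Or.inr (Or.inl h2)
  · let K := AlgebraicClosure (ZMod p)
    let φ := moebius (ZMod p) K
    have hcop : (Nat.card H).Coprime p :=
      (((Fact.out : p.Prime).coprime_iff_not_dvd).mpr hpH).symm
    have : Finite (H.map φ) := Finite.of_surjective _ (φ.subgroupMap_surjective H)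
    have hfix (h : H.map φ) (hh : h ≠ 1) :
        (MulAction.fixedBy (OnePoint K) h).ncard = 2 := by
      obtain ⟨_, k, hk, rfl⟩ := h
      have hkc : k ∉ Subgroup.center SL(2, ZMod p) := fun hc =>
        hh (Subtype.ext ((moebius_eq_one_iff k).mpr hc))
      refine ncard_fixedPoints_moebius (two_ne_zero_of_two_lt hp2)
        (discr_ne_zero_of_coprime hp2 hkc hcop ?_)
      exact congrArg Subtype.val (pow_card_eq_one' (x := (⟨k, hk⟩ : H)))
    let g' : H.map φ := ⟨φ g, Subgroup.mem_map_of_mem φ hgH⟩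
    let y' : H.map φ := ⟨φ y, Subgroup.mem_map_of_mem φ hyH⟩
    have hg' : g' ^ 2 ≠ 1 := by
      intro h
      have h1 : φ (g ^ 2) = 1 := by rw [map_pow]; exact congrArg Subtype.val h
      exact hg ((moebius_eq_one_iff _).mp h1)
    have hne : (OnePoint.infty : OnePoint K) ≠ ((0 : K) : OnePoint K) := OnePoint.infty_ne_coe _
    rcases orderOf_le_five_or_fixes hfix hne hg' ((moebius_infty_eq_iff g).mpr hg10)
      ((moebius_zero_eq_iff g).mpr hg01) with h | h | h | h
    · by_cases hc : g * y ∈ Subgroup.center SL(2, ZMod p)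
      · exact Or.inr (Or.inl (hdiag hc))
      · refine Or.inr (Or.inr (trace_of_pow_mem_center hc (orderOf_pos (g' * y')) (h _) ?_ ht))
        rw [← moebius_eq_one_iff (K := K), map_pow, map_mul]
        exact congrArg Subtype.val (pow_orderOf_eq_one (g' * y'))
    · exact Or.inr (Or.inl ((moebius_infty_eq_iff y).mp (h y')))
    · exact Or.inl ((moebius_zero_eq_iff y).mp (h y'))
    · rcases h y' with h | h
      · exact Or.inr (Or.inl ((moebius_infty_eq_iff y).mp h))
      · have h00 := (moebius_infty_eq_zero_iff y).mp h
        have h11 : y 1 1 = 0 := by linear_combination hy - h00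
        right; right
        have : t = 0 := by
          rw [ht, mul_apply_fin_two, mul_apply_fin_two, h00, h11, hg01, hg10]
          ring
        rw [this]
        ring

end Dichotomy

section Counting

open Polynomial

lemma _root_.Polynomial.ncard_setOf_isRoot_le {R : Type*} [CommRing R] [IsDomain R] {f : R[X]}
    (hf : f ≠ 0) : {a | f.IsRoot a}.ncard ≤ f.natDegree := by
  classical
  have : {a | f.IsRoot a} = (f.roots.toFinset : Set R) := by
    ext a
    simp [hf]
  rw [this, Set.ncard_coe_finset]
  exact (Multiset.toFinset_card_le _).trans (card_roots' f)

variable {p : ℕ} [Fact p.Prime]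

lemma ncard_sq_eq_neg_one_le : {a : ZMod p | a ^ 2 = -1}.ncard ≤ 2 := by
  have hd : (X ^ 2 + 1 : (ZMod p)[X]).natDegree = 2 := by compute_degree!
  have h := ncard_setOf_isRoot_le (f := (X ^ 2 + 1 : (ZMod p)[X]))
    (fun h => by simp [h] at hd)
  rw [hd] at h
  simpa [add_eq_zero_iff_eq_neg] using h

lemma ncard_trace_root_le : {t : ZMod p |
    t * (t ^ 2 - 1) * (t ^ 2 - 2) * (t ^ 4 - 3 * t ^ 2 + 1) = 0}.ncard ≤ 9 := by
  have hm : (X * (X ^ 2 - 1) * (X ^ 2 - 2) * (X ^ 4 - 3 * X ^ 2 + 1) : (ZMod p)[X]).Monic := by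
    monicity!
  have hd : (X * (X ^ 2 - 1) * (X ^ 2 - 2) * (X ^ 4 - 3 * X ^ 2 + 1) : (ZMod p)[X]).natDegree
      ≤ 9 := by
    compute_degree!
  have h := (ncard_setOf_isRoot_le hm.ne_zero).trans hd
  simpa using h

lemma ncard_trace_zero_le (hp2 : 2 < p) {k : ZMod p} (hk : k ≠ 0) :
    {y : SL(2, ZMod p) | y 0 0 + y 1 1 = 0 ∧ (y 0 1 = 0 ∨ y 1 0 = 0 ∨
      (k * y 0 0) * ((k * y 0 0) ^ 2 - 1) * ((k * y 0 0) ^ 2 - 2) *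
        ((k * y 0 0) ^ 4 - 3 * (k * y 0 0) ^ 2 + 1) = 0)}.ncard ≤ 13 * (p - 1) + 4 := by
  have ext2 {y z : SL(2, ZMod p)} (hy : y 0 0 + y 1 1 = 0) (hz : z 0 0 + z 1 1 = 0)
      (h00 : y 0 0 = z 0 0) (h01 : y 0 1 = z 0 1) (h10 : y 1 0 = z 1 0) : y = z := by
    ext i j
    fin_cases i <;> fin_cases j
    · exact h00
    · exact h01
    · exact h10
    · exact (by linear_combination hy - hz - h00 : y 1 1 = z 1 1)
  set Q : Set (ZMod p) := {t | t * (t ^ 2 - 1) * (t ^ 2 - 2) * (t ^ 4 - 3 * t ^ 2 + 1) = 0}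
  set I : Set (ZMod p) := {a | a ^ 2 = -1}
  let S₁ : Set SL(2, ZMod p) := {y | y 0 0 + y 1 1 = 0 ∧ y 0 1 = 0}
  let S₂ : Set SL(2, ZMod p) := {y | y 0 0 + y 1 1 = 0 ∧ y 1 0 = 0}
  let S₃ : Set SL(2, ZMod p) := {y | y 0 0 + y 1 1 = 0 ∧ y 0 1 ≠ 0 ∧ k * y 0 0 ∈ Q}
  have hI : I.ncard ≤ 2 := ncard_sq_eq_neg_one_le
  have hQ : Q.ncard ≤ 9 := ncard_trace_root_le
  have h₁ : S₁.ncard ≤ 2 * p := by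
    refine (Set.ncard_le_ncard_of_injOn (fun y => (y 0 0, y 1 0)) (t := I ×ˢ Set.univ)
      ?_ ?_).trans ?_
    · rintro y ⟨h, h'⟩
      have hd := det_fin_two_eq_one y
      refine ⟨?_, trivial⟩
      change y 0 0 ^ 2 = -1
      linear_combination y 0 0 * h - hd - y 1 0 * h'
    · rintro y ⟨hy, hy'⟩ z ⟨hz, hz'⟩ h
      rw [Prod.mk.injEq] at h
      exact ext2 hy hz h.1 (hy'.trans hz'.symm) h.2
    · rw [Set.ncard_prod, Set.ncard_univ, Nat.card_zmod]
      gcongr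
  have h₂ : S₂.ncard ≤ 2 * p := by
    refine (Set.ncard_le_ncard_of_injOn (fun y => (y 0 0, y 0 1)) (t := I ×ˢ Set.univ)
      ?_ ?_).trans ?_
    · rintro y ⟨h, h'⟩
      have hd := det_fin_two_eq_one y
      refine ⟨?_, trivial⟩
      change y 0 0 ^ 2 = -1
      linear_combination y 0 0 * h - hd - y 0 1 * h'
    · rintro y ⟨hy, hy'⟩ z ⟨hz, hz'⟩ h
      rw [Prod.mk.injEq] at h
      exact ext2 hy hz h.1 h.2 (hy'.trans hz'.symm)
    · rw [Set.ncard_prod, Set.ncard_univ, Nat.card_zmod]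
      gcongr
  have h₃ : S₃.ncard ≤ 9 * (p - 1) := by
    refine (Set.ncard_le_ncard_of_injOn (fun y => (k * y 0 0, y 0 1)) (t := Q ×ˢ {0}ᶜ)
      ?_ ?_).trans ?_
    · rintro y ⟨h, h', h''⟩
      exact ⟨h'', h'⟩
    · rintro y ⟨hy, hy', -⟩ z ⟨hz, hz', -⟩ h
      rw [Prod.mk.injEq] at h
      have h00 := mul_left_cancel₀ hk h.1
      have hdy := det_fin_two_eq_one y
      have hdz := det_fin_two_eq_one z
      refine ext2 hy hz h00 h.2 (mul_left_cancel₀ hy' ?_)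
      rw [h00] at hy hdy
      rw [← h.2] at hdz
      linear_combination hdz - hdy + z 0 0 * (hy - hz)
    · rw [Set.ncard_prod, Set.ncard_compl, Set.ncard_singleton, Nat.card_zmod]
      gcongr
  calc _ ≤ (S₁ ∪ S₂ ∪ S₃).ncard := Set.ncard_le_ncard (by
        rintro y ⟨hy, h | h | h⟩
        · exact Or.inl (Or.inl ⟨hy, h⟩)
        · exact Or.inl (Or.inr ⟨hy, h⟩)
        · by_cases h01 : y 0 1 = 0
          · exact Or.inl (Or.inl ⟨hy, h01⟩)
          · exact Or.inr ⟨hy, h01, h⟩)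
    _ ≤ S₁.ncard + S₂.ncard + S₃.ncard := (Set.ncard_union_le _ _).trans
        (Nat.add_le_add_right (Set.ncard_union_le _ _) _)
    _ ≤ 13 * (p - 1) + 4 := by omega

lemma two_mul_ncard_le_ncard_preimage_mk (hp2 : 2 < p) (S : Set PSL(2, ZMod p)) :
    2 * S.ncard ≤ ((QuotientGroup.mk : SL(2, ZMod p) → PSL(2, ZMod p)) ⁻¹' S).ncard := by
  rw [← Nat.card_coe_set_eq, ← Nat.card_coe_set_eq,
    Nat.card_congr (QuotientGroup.preimageMkEquivSubgroupProdSet _ S), Nat.card_prod]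
  refine Nat.mul_le_mul_right _ ?_
  have : Nontrivial (Subgroup.center SL(2, ZMod p)) :=
    (Subgroup.nontrivial_iff_exists_ne_one _).mpr
      ⟨-1, mem_center_iff_fin_two.mpr (by simp), fun h => two_ne_zero_of_two_lt hp2 ?_⟩
  · exact Finite.one_lt_card
  · have := congrArg (fun g : SL(2, ZMod p) => g 0 0) h
    simp at this
    linear_combination -this

end Counting

end Matrix.SpecialLinearGroup

open Matrix.SpecialLinearGroup

theorem coclique_bound_main2b (p : ℕ) (hp : p.Prime) (hp2 : 2 < p)
    (A : Set PSL(2, ZMod p)) (hA : IsMaximalCoclique A)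
    (hnotmax : ∀ M : Subgroup PSL(2, ZMod p), IsCoatom M → A ≠ (M : Set PSL(2, ZMod p)))
    (x : PSL(2, ZMod p)) (hxA : x ∈ A) (hx2 : 2 < orderOf x)
    (hinv : ∀ y ∈ A, y ∉ Subgroup.zpowers x → orderOf y = 2)
    (hxdvd : orderOf x ∣ p - 1)
    (hA5S4 : HasMaximalSubgroupIsoTo PSL(2, ZMod p) (alternatingGroup (Fin 5)) ∨
      HasMaximalSubgroupIsoTo PSL(2, ZMod p) (Equiv.Perm (Fin 4))) :
    2 * A.ncard ≤ 21 * (p - 1) + 10 := by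
  have : Fact p.Prime := ⟨hp⟩
  obtain ⟨g, rfl⟩ := QuotientGroup.mk_surjective x
  have hpow {n : ℕ} : g ^ n ∈ Subgroup.center SL(2, ZMod p) ↔
      orderOf (g : PSL(2, ZMod p)) ∣ n := by
    rw [orderOf_dvd_iff_pow_eq_one, ← QuotientGroup.mk_pow, QuotientGroup.eq_one_iff]
  obtain ⟨d, hd, hd0⟩ : ∃ d, (g 0 0 + g 1 1) ^ 2 - 4 = d ^ 2 ∧ d ≠ 0 := by
    by_cases hsq : IsSquare ((g 0 0 + g 1 1) ^ 2 - 4)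
    · obtain ⟨d, hd⟩ := hsq
      refine ⟨d, by rw [hd, sq], ?_⟩
      rintro rfl
      have h1 := hpow.mp (pow_card_mem_center hp2 (by rw [hd, mul_zero]))
      have h2 := (Nat.dvd_sub_iff_right (by omega) h1).mp hxdvd
      have := Nat.le_of_dvd one_pos h2
      omega
    · have h1 := hpow.mp (pow_card_succ_eq_one hp2 hsq ▸ Subgroup.one_mem _)
      rw [(by omega : p + 1 = p - 1 + 2), Nat.dvd_add_right hxdvd] at h1
      have := Nat.le_of_dvd two_pos h1
      omega
  obtain ⟨P, h01, h10, hne⟩ := exists_conj_diagonal g hd hd0 (two_ne_zero_of_two_lt hp2)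
  have hconj {h : SL(2, ZMod p)} : P⁻¹ * h * P ∈ Subgroup.center SL(2, ZMod p) ↔
      h ∈ Subgroup.center SL(2, ZMod p) := by
    rw [Subgroup.Normal.mem_comm_iff inferInstance, mul_inv_cancel_left]
  have hconj_sq (h : SL(2, ZMod p)) : (P⁻¹ * h * P) ^ 2 = P⁻¹ * h ^ 2 * P := by
    rw [sq, sq]
    group
  have hg2 : (P⁻¹ * g * P) ^ 2 ∉ Subgroup.center SL(2, ZMod p) := by
    rw [hconj_sq, hconj, hpow]
    exact Nat.not_dvd_of_pos_of_lt two_pos hx2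
  set S := A \ (Subgroup.zpowers (g : PSL(2, ZMod p)) : Set PSL(2, ZMod p))
  have hS : ((QuotientGroup.mk : SL(2, ZMod p) → PSL(2, ZMod p)) ⁻¹' S).ncard ≤
      13 * (p - 1) + 4 := by
    refine (Set.ncard_le_ncard_of_injOn (fun y => P⁻¹ * y * P) ?_ ?_).trans
      (ncard_trace_zero_le hp2 (sub_ne_zero.mpr hne))
    · intro y ⟨hyA, hyx⟩
      have hy2 := hinv _ hyA hyx
      have hyc : P⁻¹ * y * P ∉ Subgroup.center SL(2, ZMod p) := by
        rw [hconj, ← QuotientGroup.eq_one_iff, ← orderOf_eq_one_iff]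
        exact hy2.trans_ne (by decide)
      have hy2' : (P⁻¹ * y * P) ^ 2 ∈ Subgroup.center SL(2, ZMod p) := by
        rw [hconj_sq, hconj, ← QuotientGroup.eq_one_iff, QuotientGroup.mk_pow,
          ← orderOf_dvd_iff_pow_eq_one]
        exact dvd_of_eq hy2
      have htr := trace_eq_zero_of_sq_mem_center hyc hy2'
      refine ⟨htr, triangular_or_trace_of_closure_ne_top hp2 h01 h10 hg2 htr ?_ ?_⟩
      · intro htop
        refine hA.1 _ hxA _ hyA ?_
        let φ := (QuotientGroup.mk' (Subgroup.center SL(2, ZMod p))).comp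
          (MulAut.conj P).toMonoidHom
        have hφ : Function.Surjective φ :=
          (QuotientGroup.mk'_surjective _).comp (MulAut.conj P).surjective
        have := congrArg (Subgroup.map φ) htop
        rw [MonoidHom.map_closure, Set.image_pair, Subgroup.map_top_of_surjective _ hφ] at this
        simpa [φ, mul_assoc] using this
      · rw [mul_apply_fin_two (P⁻¹ * g * P), mul_apply_fin_two (P⁻¹ * g * P), h01, h10]
        linear_combination -(P⁻¹ * g * P) 1 1 * htr
    · intro y _ z _ h
      simpa using h
  have hA' : A.ncard ≤ orderOf (g : PSL(2, ZMod p)) + S.ncard := by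
    rw [← Nat.card_zpowers, add_comm]
    exact Set.ncard_le_ncard_sdiff_add_ncard _ _
  have hle := Nat.le_of_dvd (by omega) hxdvd
  have := two_mul_ncard_le_ncard_preimage_mk hp2 S
  omega
end
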